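/- arXiv:2601.21366 — 4 statements merged into one kernel-verified Lean document; each statement's English description precedes it below -/
import Mathlib

section
/- Let d ≥ 2, β > 0, let σ : ℝ → ℝ be continuous, Φ a primitive of 2σ, and fix weights ω₁,…,ω_d ∈ ℝ, a₁,…,a_d ∈ ℝ^d. Define v(x) = Σ_{j=1}^{d} ω_j Φ(⟨a_j, x⟩) and E[μ] = (1/(2β)) ∬ exp(β ⟨x,y⟩) dμ(x) dμ(y) + (1/2) ∫ v dμ over Borel probability measures μ on S^{d-1}. Then E admits a unique global minimizer μ*, and μ* is invariant under every orthogonal transformation R ∈ O(d) that fixes every a_j with ω_j ≠ 0 (i.e. R a_j = a_j for all such j implies the pushforward R_# μ* = μ*). -/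
open MeasureTheory Real
open scoped RealInnerProductSpace

/-- The perceptron potential `v(x) = Σ_j ω_j Φ(⟨a_j, x⟩)`, where `Φ` is a primitive
of `2σ`. -/
noncomputable def perceptronPotential {d : ℕ} (ω : Fin d → ℝ)
    (a : Fin d → EuclideanSpace ℝ (Fin d)) (Φ : ℝ → ℝ)
    (x : EuclideanSpace ℝ (Fin d)) : ℝ :=
  ∑ j, ω j * Φ ⟪a j, x⟫

/-- The attention–perceptron energy
`E[μ] = (1/(2β)) ∬ e^{β⟨x,y⟩} dμ dμ + (1/2) ∫ v dμ`. -/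
noncomputable def attnEnergy {d : ℕ} (β : ℝ) (ω : Fin d → ℝ)
    (a : Fin d → EuclideanSpace ℝ (Fin d)) (Φ : ℝ → ℝ)
    (μ : Measure (EuclideanSpace ℝ (Fin d))) : ℝ :=
  (1 / (2 * β)) * ∫ x, ∫ y, Real.exp (β * ⟪x, y⟫) ∂μ ∂μ
    + (1 / 2) * ∫ x, perceptronPotential ω a Φ x ∂μ

/-- The Gaussian integral representation of the exponential kernel on the unit sphere. -/
lemma integral_gaussian_mul_cexp_inner {V : Type*} [NormedAddCommGroup V] [InnerProductSpace ℝ V]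
    [FiniteDimensional ℝ V] [MeasurableSpace V] [BorelSpace V] {β : ℝ} (hβ : 0 < β) {x y : V}
    (hx : ‖x‖ = 1) (hy : ‖y‖ = 1) :
    ∫ t : V, (Real.exp (-(1 / (2 * β)) * ‖t‖ ^ 2) : ℂ) * Complex.exp (⟪x, t⟫ * Complex.I) *
        Complex.exp (-(⟪y, t⟫ * Complex.I)) =
      (((∫ t : V, Real.exp (-(1 / (2 * β)) * ‖t‖ ^ 2)) * Real.exp (-β) *
        Real.exp (β * ⟪x, y⟫) : ℝ) : ℂ) := by
  have hb : 0 < ((1 / (2 * β) : ℝ) : ℂ).re := by rw [Complex.ofReal_re]; positivity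
  have h := GaussianFourier.integral_cexp_neg_mul_sq_norm_add hb Complex.I (x - y)
  have h0 := GaussianFourier.integral_cexp_neg_mul_sq_norm (V := V) hb
  rw [← h0] at h
  have hn : ‖x - y‖ ^ 2 = 2 - 2 * ⟪x, y⟫ := by
    rw [norm_sub_sq_real, hx, hy]; ring
  have e1 : ∀ t : V, (Real.exp (-(1 / (2 * β)) * ‖t‖ ^ 2) : ℂ) *
      Complex.exp (⟪x, t⟫ * Complex.I) * Complex.exp (-(⟪y, t⟫ * Complex.I)) =
      Complex.exp (-((1 / (2 * β) : ℝ) : ℂ) * ‖t‖ ^ 2 + Complex.I * ⟪x - y, t⟫) := by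
    intro t
    rw [Complex.ofReal_exp, ← Complex.exp_add, ← Complex.exp_add, inner_sub_left]
    congr 1
    push_cast
    ring
  simp_rw [e1]
  rw [h]
  have e2 : ∫ t : V, Complex.exp (-((1 / (2 * β) : ℝ) : ℂ) * ‖t‖ ^ 2) =
      ((∫ t : V, Real.exp (-(1 / (2 * β)) * ‖t‖ ^ 2) : ℝ) : ℂ) := by
    rw [← integral_complex_ofReal]
    simp
  rw [e2, mul_assoc, ← Real.exp_add, Complex.ofReal_mul, Complex.ofReal_exp]
  congr 2
  rw [Complex.I_sq, ← Complex.ofReal_pow, hn]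
  have : (β : ℂ) ≠ 0 := by exact_mod_cast hβ.ne'
  push_cast
  field_simp
  ring

lemma integrable_gaussian {V : Type*} [NormedAddCommGroup V] [InnerProductSpace ℝ V]
    [FiniteDimensional ℝ V] [MeasurableSpace V] [BorelSpace V] {b : ℝ} (hb : 0 < b) :
    Integrable fun t : V ↦ Real.exp (-b * ‖t‖ ^ 2) := by
  have h := (GaussianFourier.integrable_cexp_neg_mul_sq_norm_add (V := V) (b := (b : ℂ))
    (by simpa using hb) 0 0).re
  refine h.congr (ae_of_all _ fun t ↦ ?_)
  have : -(b : ℂ) * ‖t‖ ^ 2 + 0 * ⟪(0 : V), t⟫ = ((-b * ‖t‖ ^ 2 : ℝ) : ℂ) := by push_cast; ring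
  simp only [this, ← Complex.ofReal_exp]
  exact Complex.ofReal_re _

/-- The Gaussian-weighted squared `L²` norm of the characteristic function. -/
noncomputable def gaussianCharFunSq {V : Type*} [NormedAddCommGroup V] [InnerProductSpace ℝ V]
    [FiniteDimensional ℝ V] [MeasurableSpace V] [BorelSpace V] (b : ℝ) (μ : Measure V) : ℝ :=
  ∫ t : V, Real.exp (-b * ‖t‖ ^ 2) * ‖charFun μ t‖ ^ 2

lemma ae_norm_eq_one_of_sphere {V : Type*} [NormedAddCommGroup V] [MeasurableSpace V]
    {μ : Measure V} (hμ : μ (Metric.sphere (0 : V) 1)ᶜ = 0) :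
    ∀ᵐ x ∂μ, ‖x‖ = 1 := by
  filter_upwards [mem_ae_iff.2 hμ] with x hx using by simpa using hx

lemma continuous_charFun_of_isFiniteMeasure {V : Type*} [NormedAddCommGroup V]
    [InnerProductSpace ℝ V] [MeasurableSpace V] [BorelSpace V] [SecondCountableTopology V]
    (μ : Measure V) [IsFiniteMeasure μ] :
    Continuous (charFun μ) := by
  simp_rw [funext fun t ↦ charFun_apply (μ := μ) t]
  refine continuous_of_dominated (bound := fun _ ↦ 1)
    (fun t ↦ Continuous.aestronglyMeasurable (by fun_prop)) (fun t ↦ ae_of_all _ fun x ↦ ?_)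
    (integrable_const 1) (ae_of_all _ fun x ↦ by fun_prop)
  rw [Complex.norm_exp_ofReal_mul_I]

/-- The average of two measures. -/
noncomputable def midMeasure {V : Type*} [MeasurableSpace V] (μ ν : Measure V) : Measure V :=
  (2⁻¹ : ENNReal) • μ + (2⁻¹ : ENNReal) • ν

instance {V : Type*} [MeasurableSpace V] (μ ν : Measure V) [IsProbabilityMeasure μ]
    [IsProbabilityMeasure ν] :
    IsProbabilityMeasure (midMeasure μ ν) :=
  ⟨by simp [midMeasure, ENNReal.inv_two_add_inv_two]⟩

lemma integral_midMeasure {V : Type*} [MeasurableSpace V] {G : Type*} [NormedAddCommGroup G]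
    [NormedSpace ℝ G]
    {μ ν : Measure V} {f : V → G} (hμ : Integrable f μ) (hν : Integrable f ν) :
    ∫ x, f x ∂midMeasure μ ν = (2⁻¹ : ℝ) • ∫ x, f x ∂μ + (2⁻¹ : ℝ) • ∫ x, f x ∂ν := by
  rw [midMeasure, integral_add_measure (hμ.smul_measure (by simp)) (hν.smul_measure (by simp)),
    integral_smul_measure, integral_smul_measure]
  simp

section

variable {V : Type*} [NormedAddCommGroup V] [InnerProductSpace ℝ V]
  [FiniteDimensional ℝ V] [MeasurableSpace V] [BorelSpace V]

lemma gaussianCharFunSq_eq {β : ℝ} (hβ : 0 < β) (μ : Measure V) [IsProbabilityMeasure μ]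
    (hμ : μ (Metric.sphere (0 : V) 1)ᶜ = 0) :
    gaussianCharFunSq (1 / (2 * β)) μ =
      (∫ t : V, Real.exp (-(1 / (2 * β)) * ‖t‖ ^ 2)) * Real.exp (-β) *
        ∫ x, ∫ y, Real.exp (β * ⟪x, y⟫) ∂μ ∂μ := by
  have hae := ae_norm_eq_one_of_sphere hμ
  have hae2 : ∀ᵐ p ∂μ.prod μ, ‖p.1‖ = 1 ∧ ‖p.2‖ = 1 :=
    (Measure.quasiMeasurePreserving_fst.ae hae).and (Measure.quasiMeasurePreserving_snd.ae hae)
  have hk : Integrable (fun p : V × V ↦ Real.exp (β * ⟪p.1, p.2⟫)) (μ.prod μ) := by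
    refine Integrable.mono' (integrable_const (Real.exp β))
      (by fun_prop : Continuous fun p : V × V ↦ Real.exp (β * ⟪p.1, p.2⟫)).aestronglyMeasurable ?_
    filter_upwards [hae2] with p hp
    rw [Real.norm_eq_abs, abs_of_pos (Real.exp_pos _), Real.exp_le_exp]
    have := real_inner_le_norm p.1 p.2
    rw [hp.1, hp.2] at this
    nlinarith
  rw [← integral_prod _ hk]
  set F : V → V × V → ℂ := fun t p ↦ (Real.exp (-(1 / (2 * β)) * ‖t‖ ^ 2) : ℂ) *
    Complex.exp (⟪p.1, t⟫ * Complex.I) * Complex.exp (-(⟪p.2, t⟫ * Complex.I)) with hF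
  have hFi : Integrable (Function.uncurry F) ((volume : Measure V).prod (μ.prod μ)) := by
    refine Integrable.mono' ((integrable_gaussian (V := V) (b := 1 / (2 * β))
      (by positivity)).comp_fst (μ.prod μ)) (Continuous.aestronglyMeasurable ?_) ?_
    · simp only [hF, Function.uncurry_def]
      fun_prop
    · refine ae_of_all _ fun q ↦ le_of_eq ?_
      simp only [hF, Function.uncurry_def]
      rw [← neg_mul, ← Complex.ofReal_neg, norm_mul, norm_mul, Complex.norm_exp_ofReal_mul_I,
        Complex.norm_exp_ofReal_mul_I, Complex.norm_real, Real.norm_eq_abs,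
        abs_of_pos (Real.exp_pos _), mul_one, mul_one]
  have hswap := integral_integral_swap hFi
  have hl : ∀ t, ∫ p, F t p ∂μ.prod μ =
      ((Real.exp (-(1 / (2 * β)) * ‖t‖ ^ 2) * ‖charFun μ t‖ ^ 2 : ℝ) : ℂ) := by
    intro t
    simp only [hF, mul_assoc]
    rw [integral_const_mul, integral_prod_mul (fun x : V ↦ Complex.exp (⟪x, t⟫ * Complex.I))
      (fun y : V ↦ Complex.exp (-(⟪y, t⟫ * Complex.I))), ← charFun_apply]
    have : ∫ y, Complex.exp (-(⟪y, t⟫ * Complex.I)) ∂μ =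
        (starRingEnd ℂ) (charFun μ t) := by
      rw [← charFun_neg, charFun_apply]
      simp
    rw [this, Complex.mul_conj, Complex.normSq_eq_norm_sq]
    push_cast
    ring
  simp_rw [hl] at hswap
  have hr : ∫ p, (∫ t, F t p) ∂μ.prod μ = ∫ p, (((∫ t : V, Real.exp (-(1 / (2 * β)) * ‖t‖ ^ 2)) *
      Real.exp (-β) * Real.exp (β * ⟪p.1, p.2⟫) : ℝ) : ℂ) ∂μ.prod μ := by
    refine integral_congr_ae ?_
    filter_upwards [hae2] with p hp
    exact integral_gaussian_mul_cexp_inner hβ hp.1 hp.2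
  rw [hr, integral_complex_ofReal, integral_complex_ofReal, integral_const_mul] at hswap
  exact_mod_cast hswap

lemma integrable_gaussian_mul_norm_sq {b : ℝ} (hb : 0 < b) {f : V → ℂ} (hf : Continuous f) {C : ℝ}
    (hC : ∀ t, ‖f t‖ ≤ C) :
    Integrable fun t : V ↦ Real.exp (-b * ‖t‖ ^ 2) * ‖f t‖ ^ 2 := by
  refine ((integrable_gaussian (V := V) hb).mul_const (C ^ 2)).mono'
    (Continuous.aestronglyMeasurable (by fun_prop)) (ae_of_all _ fun t ↦ ?_)
  rw [Real.norm_of_nonneg (by positivity)]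
  gcongr
  exact hC t

lemma charFun_midMeasure (μ ν : Measure V) [IsProbabilityMeasure μ] [IsProbabilityMeasure ν]
    (t : V) : charFun (midMeasure μ ν) t = (2⁻¹ : ℝ) • (charFun μ t + charFun ν t) := by
  have h : ∀ (ρ : Measure V) [IsProbabilityMeasure ρ],
      Integrable (fun x ↦ Complex.exp (⟪x, t⟫ * Complex.I)) ρ := fun ρ _ ↦
    (integrable_const (1 : ℝ)).mono' (Continuous.aestronglyMeasurable (by fun_prop))
      (ae_of_all _ fun x ↦ by rw [Complex.norm_exp_ofReal_mul_I])
  simp only [charFun_apply]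
  rw [integral_midMeasure (h μ) (h ν), smul_add]

/-- The weighted form is convex, with equality at midpoints only for equal measures. -/
lemma eq_of_gaussianCharFunSq_midMeasure {b : ℝ} (hb : 0 < b) (μ ν : Measure V)
    [IsProbabilityMeasure μ] [IsProbabilityMeasure ν]
    (h : (gaussianCharFunSq b μ + gaussianCharFunSq b ν) / 2 ≤
      gaussianCharFunSq b (midMeasure μ ν)) : μ = ν := by
  have cμ := continuous_charFun_of_isFiniteMeasure μ
  have cν := continuous_charFun_of_isFiniteMeasure ν
  have iμ := integrable_gaussian_mul_norm_sq hb cμ norm_charFun_le_one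
  have iν := integrable_gaussian_mul_norm_sq hb cν norm_charFun_le_one
  have im := integrable_gaussian_mul_norm_sq hb
    (continuous_charFun_of_isFiniteMeasure (midMeasure μ ν)) norm_charFun_le_one
  have cd : Continuous fun t ↦ Real.exp (-b * ‖t‖ ^ 2) * ‖charFun μ t - charFun ν t‖ ^ 2 := by
    fun_prop
  have key : ∀ t, Real.exp (-b * ‖t‖ ^ 2) * ‖charFun μ t - charFun ν t‖ ^ 2 =
      2 * (Real.exp (-b * ‖t‖ ^ 2) * ‖charFun μ t‖ ^ 2) +
      2 * (Real.exp (-b * ‖t‖ ^ 2) * ‖charFun ν t‖ ^ 2) -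
      4 * (Real.exp (-b * ‖t‖ ^ 2) * ‖charFun (midMeasure μ ν) t‖ ^ 2) := by
    intro t
    rw [charFun_midMeasure, norm_smul]
    have := parallelogram_law_with_norm ℝ (charFun μ t) (charFun ν t)
    rw [Real.norm_of_nonneg (by norm_num)]
    linear_combination (Real.exp (-b * ‖t‖ ^ 2)) * this
  have hle : ∫ t, Real.exp (-b * ‖t‖ ^ 2) * ‖charFun μ t - charFun ν t‖ ^ 2 ≤ 0 := by
    simp_rw [key]
    have hadd : Integrable fun t ↦ 2 * (Real.exp (-b * ‖t‖ ^ 2) * ‖charFun μ t‖ ^ 2) +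
        2 * (Real.exp (-b * ‖t‖ ^ 2) * ‖charFun ν t‖ ^ 2) :=
      (iμ.const_mul 2).add (iν.const_mul 2)
    rw [integral_sub hadd (im.const_mul 4),
      integral_add (iμ.const_mul 2) (iν.const_mul 2), integral_const_mul, integral_const_mul,
      integral_const_mul]
    simp only [gaussianCharFunSq] at h
    linarith
  have hi : Integrable fun t ↦ Real.exp (-b * ‖t‖ ^ 2) * ‖charFun μ t - charFun ν t‖ ^ 2 :=
    (((iμ.const_mul 2).add (iν.const_mul 2)).sub (im.const_mul 4)).congr
      (ae_of_all _ fun t ↦ (key t).symm)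
  have h0 := (integral_eq_zero_iff_of_nonneg (fun t ↦ by positivity) hi).1
    (le_antisymm hle (integral_nonneg fun t ↦ by positivity))
  have h1 := (Continuous.ae_eq_iff_eq volume cd continuous_const).1 h0
  refine Measure.ext_of_charFun (funext fun t ↦ ?_)
  have h2 : Real.exp (-b * ‖t‖ ^ 2) * ‖charFun μ t - charFun ν t‖ ^ 2 = 0 := congrFun h1 t
  simpa [sub_eq_zero, (Real.exp_pos _).ne'] using h2

/-- Continuity in the weak topology on probability measures on the sphere. -/
lemma continuous_gaussianCharFunSq_map {b : ℝ} (hb : 0 < b) :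
    Continuous fun P : ProbabilityMeasure (Metric.sphere (0 : V) 1) ↦
      gaussianCharFunSq b ((P : Measure (Metric.sphere (0 : V) 1)).map Subtype.val) := by
  have hprob : ∀ P : ProbabilityMeasure (Metric.sphere (0 : V) 1),
      IsProbabilityMeasure ((P : Measure (Metric.sphere (0 : V) 1)).map Subtype.val) :=
    fun P ↦ Measure.isProbabilityMeasure_map measurable_subtype_coe.aemeasurable
  refine continuous_of_dominated (bound := fun t ↦ Real.exp (-b * ‖t‖ ^ 2))
    (fun P ↦ ?_) (fun P ↦ ae_of_all _ fun t ↦ ?_) (integrable_gaussian hb)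
    (ae_of_all _ fun t ↦ ?_)
  · have := hprob P
    exact (integrable_gaussian_mul_norm_sq hb (continuous_charFun_of_isFiniteMeasure _)
      norm_charFun_le_one).aestronglyMeasurable
  · have := hprob P
    rw [Real.norm_of_nonneg (by positivity)]
    refine mul_le_of_le_one_right (by positivity) (pow_le_one₀ (norm_nonneg _) ?_)
    exact norm_charFun_le_one t
  · have hc : Continuous fun P : ProbabilityMeasure (Metric.sphere (0 : V) 1) ↦
        charFun ((P : Measure (Metric.sphere (0 : V) 1)).map Subtype.val) t := by
      have : ∀ P : ProbabilityMeasure (Metric.sphere (0 : V) 1),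
          charFun ((P : Measure (Metric.sphere (0 : V) 1)).map Subtype.val) t =
          ∫ x, ((BoundedContinuousFunction.innerProbChar t).compContinuous
            ⟨Subtype.val, continuous_subtype_val⟩) x ∂(P : Measure (Metric.sphere (0 : V) 1)) := by
        intro P
        rw [charFun_eq_integral_innerProbChar, integral_map measurable_subtype_coe.aemeasurable
          (BoundedContinuousFunction.continuous _).aestronglyMeasurable]
        rfl
      simp_rw [this]
      rw [continuous_iff_continuousAt]
      intro P
      exact (ProbabilityMeasure.tendsto_iff_forall_integral_rclike_tendsto ℂ).1
        Filter.tendsto_id _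
    fun_prop

lemma integrable_of_continuous_of_sphere {μ : Measure V} [IsProbabilityMeasure μ]
    (hμ : μ (Metric.sphere (0 : V) 1)ᶜ = 0) {f : V → ℝ} (hf : Continuous f) :
    Integrable f μ := by
  have : μ.restrict (Metric.sphere (0 : V) 1) = μ :=
    Measure.restrict_eq_self_of_ae_mem (mem_ae_iff.2 hμ)
  rw [← this]
  exact hf.continuousOn.integrableOn_compact (isCompact_sphere _ _)

end

section

variable {d : ℕ} {β : ℝ} {ω : Fin d → ℝ} {a : Fin d → EuclideanSpace ℝ (Fin d)} {Φ : ℝ → ℝ}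

lemma continuous_perceptronPotential (hΦ : Continuous Φ) :
    Continuous (perceptronPotential ω a Φ) := by
  unfold perceptronPotential
  fun_prop

/-- The energy is a positive multiple of the Gaussian-weighted form plus a linear term. -/
lemma exists_attnEnergy_eq (hβ : 0 < β) (ω : Fin d → ℝ) (a : Fin d → EuclideanSpace ℝ (Fin d))
    (Φ : ℝ → ℝ) :
    ∃ C : ℝ, 0 < C ∧ ∀ μ : Measure (EuclideanSpace ℝ (Fin d)), IsProbabilityMeasure μ →
      μ (Metric.sphere (0 : EuclideanSpace ℝ (Fin d)) 1)ᶜ = 0 →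
      attnEnergy β ω a Φ μ = C * gaussianCharFunSq (1 / (2 * β)) μ +
        (1 / 2) * ∫ x, perceptronPotential ω a Φ x ∂μ := by
  have hG : 0 < ∫ t : EuclideanSpace ℝ (Fin d), Real.exp (-(1 / (2 * β)) * ‖t‖ ^ 2) :=
    integral_exp_pos (integrable_gaussian (by positivity))
  refine ⟨(1 / (2 * β)) / ((∫ t : EuclideanSpace ℝ (Fin d),
    Real.exp (-(1 / (2 * β)) * ‖t‖ ^ 2)) * Real.exp (-β)), by positivity, fun μ _ hμ ↦ ?_⟩
  rw [gaussianCharFunSq_eq hβ μ hμ, attnEnergy, ← mul_assoc, div_mul_cancel₀ _ (by positivity)]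

lemma exists_attnEnergy_minimizer (hd : 2 ≤ d) (hβ : 0 < β) (hΦ : Continuous Φ) :
    ∃ μ : Measure (EuclideanSpace ℝ (Fin d)), IsProbabilityMeasure μ ∧
      μ (Metric.sphere (0 : EuclideanSpace ℝ (Fin d)) 1)ᶜ = 0 ∧
      ∀ ν : Measure (EuclideanSpace ℝ (Fin d)), IsProbabilityMeasure ν →
        ν (Metric.sphere (0 : EuclideanSpace ℝ (Fin d)) 1)ᶜ = 0 →
        attnEnergy β ω a Φ μ ≤ attnEnergy β ω a Φ ν := by
  obtain ⟨C, hC, hE⟩ := exists_attnEnergy_eq hβ ω a Φ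
  let S := Metric.sphere (0 : EuclideanSpace ℝ (Fin d)) 1
  have hS : MeasurableSet S := Metric.isClosed_sphere.measurableSet
  have hprob : ∀ P : ProbabilityMeasure S,
      IsProbabilityMeasure ((P : Measure S).map Subtype.val) :=
    fun P ↦ Measure.isProbabilityMeasure_map measurable_subtype_coe.aemeasurable
  have hsupp : ∀ P : ProbabilityMeasure S, ((P : Measure S).map Subtype.val) Sᶜ = 0 := by
    intro P
    rw [Measure.map_apply measurable_subtype_coe hS.compl]
    simp
  have hlift : ∀ ν : Measure (EuclideanSpace ℝ (Fin d)), IsProbabilityMeasure ν → ν Sᶜ = 0 →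
      ∃ P : ProbabilityMeasure S, (P : Measure S).map Subtype.val = ν := by
    intro ν _ hν
    have hmap : (ν.comap Subtype.val : Measure S).map Subtype.val = ν := by
      rw [(MeasurableEmbedding.subtype_coe hS).map_comap, Subtype.range_coe]
      exact Measure.restrict_eq_self_of_ae_mem (mem_ae_iff.2 hν)
    refine ⟨⟨ν.comap Subtype.val, ⟨?_⟩⟩, hmap⟩
    have := congrArg (fun m ↦ m Set.univ) hmap
    simpa [Measure.map_apply measurable_subtype_coe MeasurableSet.univ] using this
  have hcont : Continuous fun P : ProbabilityMeasure S ↦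
      attnEnergy β ω a Φ ((P : Measure S).map Subtype.val) := by
    simp_rw [fun P ↦ hE _ (hprob P) (hsupp P)]
    refine ((continuous_gaussianCharFunSq_map (by positivity)).const_mul C).add
      (Continuous.const_mul ?_ _)
    have hv := continuous_perceptronPotential (ω := ω) (a := a) hΦ
    have : ∀ P : ProbabilityMeasure S,
        ∫ x, perceptronPotential ω a Φ x ∂((P : Measure S).map Subtype.val) =
        ∫ x, BoundedContinuousFunction.mkOfCompact
          (⟨fun x : S ↦ perceptronPotential ω a Φ x, by fun_prop⟩ : C(S, ℝ)) x
            ∂(P : Measure S) := by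
      intro P
      rw [integral_map measurable_subtype_coe.aemeasurable hv.aestronglyMeasurable]
      rfl
    simp_rw [this]
    rw [continuous_iff_continuousAt]
    intro P
    exact ProbabilityMeasure.tendsto_iff_forall_integral_tendsto.1 Filter.tendsto_id _
  have : Nonempty S :=
    ⟨⟨EuclideanSpace.single ⟨0, by omega⟩ 1, by simp [S]⟩⟩
  obtain ⟨x₀⟩ := this
  have : Nonempty (ProbabilityMeasure S) := ⟨⟨Measure.dirac x₀, inferInstance⟩⟩
  obtain ⟨P, -, hP⟩ := isCompact_univ.exists_isMinOn Set.univ_nonempty hcont.continuousOn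
  refine ⟨_, hprob P, hsupp P, fun ν hν hνS ↦ ?_⟩
  obtain ⟨Q, rfl⟩ := hlift ν hν hνS
  exact hP (Set.mem_univ Q)

lemma attnEnergy_minimizer_unique (hβ : 0 < β) (hΦ : Continuous Φ)
    {μ ν : Measure (EuclideanSpace ℝ (Fin d))} [IsProbabilityMeasure μ] [IsProbabilityMeasure ν]
    (hμ : μ (Metric.sphere (0 : EuclideanSpace ℝ (Fin d)) 1)ᶜ = 0)
    (hν : ν (Metric.sphere (0 : EuclideanSpace ℝ (Fin d)) 1)ᶜ = 0)
    (hμmin : ∀ ρ : Measure (EuclideanSpace ℝ (Fin d)), IsProbabilityMeasure ρ →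
      ρ (Metric.sphere (0 : EuclideanSpace ℝ (Fin d)) 1)ᶜ = 0 →
      attnEnergy β ω a Φ μ ≤ attnEnergy β ω a Φ ρ)
    (hle : attnEnergy β ω a Φ ν ≤ attnEnergy β ω a Φ μ) : ν = μ := by
  obtain ⟨C, hC, hE⟩ := exists_attnEnergy_eq hβ ω a Φ
  have hm : midMeasure ν μ (Metric.sphere (0 : EuclideanSpace ℝ (Fin d)) 1)ᶜ = 0 := by
    simp [midMeasure, hμ, hν]
  have hv := continuous_perceptronPotential (ω := ω) (a := a) hΦ
  have hmin := hμmin (midMeasure ν μ) inferInstance hm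
  rw [hE _ inferInstance hm, integral_midMeasure (integrable_of_continuous_of_sphere hν hv)
    (integrable_of_continuous_of_sphere hμ hv), smul_eq_mul, smul_eq_mul] at hmin
  rw [hE _ inferInstance hμ] at hmin hle
  rw [hE _ inferInstance hν] at hle
  refine eq_of_gaussianCharFunSq_midMeasure (b := 1 / (2 * β)) (by positivity) ν μ ?_
  refine le_of_mul_le_mul_left ?_ hC
  linarith

lemma attnEnergy_map (R : EuclideanSpace ℝ (Fin d) ≃ₗᵢ[ℝ] EuclideanSpace ℝ (Fin d))
    (hR : ∀ j, ω j ≠ 0 → R (a j) = a j) (μ : Measure (EuclideanSpace ℝ (Fin d))) :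
    attnEnergy β ω a Φ (μ.map R) = attnEnergy β ω a Φ μ := by
  have hRe : MeasurableEmbedding R := R.toHomeomorph.measurableEmbedding
  have hpot : ∀ x, perceptronPotential ω a Φ (R x) = perceptronPotential ω a Φ x := by
    intro x
    refine Finset.sum_congr rfl fun j _ ↦ ?_
    by_cases h : ω j = 0
    · simp [h]
    · nth_rewrite 1 [← hR j h]
      rw [R.inner_map_map]
  simp only [attnEnergy, hRe.integral_map, hpot, R.inner_map_map]

end

/-- **Existence, uniqueness and symmetry of the global minimizer** (Proposition `min.max`
(ii)). The attention–perceptron energy admits a unique global minimizer `μ*` among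
probability measures on `S^{d-1}`, and `μ*` is invariant under every orthogonal map `R`
that fixes every `a_j` with `ω_j ≠ 0`. -/
theorem unique_global_minimizer_and_symmetry
    (d : ℕ) (hd : 2 ≤ d) (β : ℝ) (hβ : 0 < β)
    (σ : ℝ → ℝ) (hσ : Continuous σ) (Φ : ℝ → ℝ) (hΦ : ∀ s : ℝ, HasDerivAt Φ (2 * σ s) s)
    (ω : Fin d → ℝ) (a : Fin d → EuclideanSpace ℝ (Fin d)) :
    ∃ μs : Measure (EuclideanSpace ℝ (Fin d)),
      (IsProbabilityMeasure μs ∧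
        μs (Metric.sphere (0 : EuclideanSpace ℝ (Fin d)) 1)ᶜ = 0 ∧
        ∀ ν : Measure (EuclideanSpace ℝ (Fin d)), IsProbabilityMeasure ν →
          ν (Metric.sphere (0 : EuclideanSpace ℝ (Fin d)) 1)ᶜ = 0 →
          attnEnergy β ω a Φ μs ≤ attnEnergy β ω a Φ ν) ∧
      (∀ ν : Measure (EuclideanSpace ℝ (Fin d)), IsProbabilityMeasure ν →
        ν (Metric.sphere (0 : EuclideanSpace ℝ (Fin d)) 1)ᶜ = 0 →
        (∀ ρ : Measure (EuclideanSpace ℝ (Fin d)), IsProbabilityMeasure ρ →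
          ρ (Metric.sphere (0 : EuclideanSpace ℝ (Fin d)) 1)ᶜ = 0 →
          attnEnergy β ω a Φ ν ≤ attnEnergy β ω a Φ ρ) → ν = μs) ∧
      (∀ R : EuclideanSpace ℝ (Fin d) ≃ₗᵢ[ℝ] EuclideanSpace ℝ (Fin d),
        (∀ j, ω j ≠ 0 → R (a j) = a j) → Measure.map R μs = μs) := by
  have hΦc : Continuous Φ := continuous_iff_continuousAt.2 fun s ↦ (hΦ s).continuousAt
  obtain ⟨μ, hp, hs, hmin⟩ := exists_attnEnergy_minimizer (ω := ω) (a := a) hd hβ hΦc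
  refine ⟨μ, ⟨hp, hs, hmin⟩, fun ν _ hν hνmin ↦ ?_, fun R hR ↦ ?_⟩
  · exact attnEnergy_minimizer_unique hβ hΦc hs hν hmin (hνmin μ hp hs)
  · have : IsProbabilityMeasure (μ.map R) :=
      Measure.isProbabilityMeasure_map R.continuous.measurable.aemeasurable
    refine attnEnergy_minimizer_unique hβ hΦc hs ?_ hmin (attnEnergy_map R hR μ).le
    rw [Measure.map_apply R.continuous.measurable Metric.isClosed_sphere.measurableSet.compl]
    convert hs using 2
    ext x
    simp
end

section
/- Let d ≥ 2 and let A be a d×d real matrix with nonnegative entries, with rows a₁,…,a_d ∈ ℝ^d. Then max over x ∈ S^{d-1} of Σ_{j=1}^{d} (max(⟨a_j, x⟩, 0))² equals ‖A‖², the square of the operator norm of A (with respect to the Euclidean norm). Moreover the maximum is attained at some unit vector x with nonnegative entries satisfying ‖A x‖ = ‖A‖, namely a nonnegative top right singular vector of A. -/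
open Real

/-- A continuous linear map on a nontrivial finite-dimensional real normed space attains its
operator norm on the unit sphere. -/
theorem ContinuousLinearMap.exists_norm_eq_one_norm_apply_eq_opNorm
    {E F : Type*} [NormedAddCommGroup E] [NormedSpace ℝ E] [FiniteDimensional ℝ E] [Nontrivial E]
    [SeminormedAddCommGroup F] [NormedSpace ℝ F] (T : E →L[ℝ] F) :
    ∃ x : E, ‖x‖ = 1 ∧ ‖T x‖ = ‖T‖ := by
  have := FiniteDimensional.proper_real E
  obtain ⟨x, hx, hmax⟩ := (isCompact_sphere (0 : E) 1).exists_isMaxOn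
    (NormedSpace.sphere_nonempty.mpr zero_le_one) (T.continuous.norm.continuousOn)
  have hx1 : ‖x‖ = 1 := by simpa using hx
  refine ⟨x, hx1, le_antisymm (T.unit_le_opNorm x hx1.le) ?_⟩
  refine T.opNorm_le_of_unit_norm (norm_nonneg _) fun y hy => ?_
  exact isMaxOn_iff.mp hmax y (by simpa using hy)

theorem Matrix.norm_toEuclideanCLM_apply_sq {n : Type*} [Fintype n] [DecidableEq n]
    (A : Matrix n n ℝ) (x : EuclideanSpace ℝ n) :
    ‖Matrix.toEuclideanCLM (𝕜 := ℝ) A x‖ ^ 2 = ∑ j, (∑ i, A j i * x i) ^ 2 := by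
  simp [EuclideanSpace.norm_sq_eq, Matrix.ofLp_toEuclideanCLM, Matrix.mulVec, dotProduct]

/-- The operator norm of an entrywise nonnegative matrix is attained at a nonnegative
unit vector. -/
theorem Matrix.exists_nonneg_norm_toEuclideanCLM_apply_eq {n : Type*} [Fintype n] [DecidableEq n]
    [Nonempty n] (A : Matrix n n ℝ) (hA : ∀ i j, 0 ≤ A i j) :
    ∃ x : EuclideanSpace ℝ n, ‖x‖ = 1 ∧ (∀ i, 0 ≤ x i) ∧
      ‖Matrix.toEuclideanCLM (𝕜 := ℝ) A x‖ = ‖Matrix.toEuclideanCLM (𝕜 := ℝ) A‖ := by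
  obtain ⟨x, hx, hAx⟩ :=
    (Matrix.toEuclideanCLM (𝕜 := ℝ) A).exists_norm_eq_one_norm_apply_eq_opNorm
  have habs : ‖(WithLp.toLp 2 fun i => |x i| : EuclideanSpace ℝ n)‖ = 1 := by
    rw [← hx]
    simp [EuclideanSpace.norm_eq]
  refine ⟨WithLp.toLp 2 fun i => |x i|, habs, fun i => abs_nonneg _,
    le_antisymm (ContinuousLinearMap.unit_le_opNorm _ _ habs.le) ?_⟩
  rw [← hAx]
  refine le_of_sq_le_sq ?_ (norm_nonneg _)
  simp only [Matrix.norm_toEuclideanCLM_apply_sq]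
  refine Finset.sum_le_sum fun j _ => sq_le_sq.mpr ((Finset.abs_sum_le_sum_abs _ _).trans ?_)
  refine le_trans (le_of_eq ?_) (le_abs_self _)
  simp [abs_mul, abs_of_nonneg (hA _ _)]

/-- **Maximum of the ReLU perceptron potential for nonnegative matrices** (explicit
maximizers, case (iii)). Let `A` be a `d × d` matrix with nonnegative entries and rows
`a_j`, so that `⟨a_j, x⟩ = (A x)_j`. Then the maximum over the unit sphere of
`Σ_j (max ⟨a_j, x⟩ 0)²` equals `‖A‖²`, the squared `ℓ² → ℓ²` operator norm of `A`, and it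
is attained at a nonnegative unit vector `x` with `‖A x‖ = ‖A‖` (a nonnegative top right
singular vector of `A`). -/
theorem relu_potential_max_eq_opNorm_sq
    (d : ℕ) (hd : 2 ≤ d) (A : Matrix (Fin d) (Fin d) ℝ)
    (hA : ∀ i j, 0 ≤ A i j) :
    IsGreatest
      {r : ℝ | ∃ x : EuclideanSpace ℝ (Fin d), ‖x‖ = 1 ∧
        r = ∑ j, max (∑ i, A j i * x i) 0 ^ 2}
      (‖Matrix.toEuclideanCLM (𝕜 := ℝ) A‖ ^ 2) ∧
    ∃ x : EuclideanSpace ℝ (Fin d), ‖x‖ = 1 ∧ (∀ i, 0 ≤ x i) ∧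
      ‖Matrix.toEuclideanCLM (𝕜 := ℝ) A x‖ = ‖Matrix.toEuclideanCLM (𝕜 := ℝ) A‖ ∧
      ∑ j, max (∑ i, A j i * x i) 0 ^ 2 = ‖Matrix.toEuclideanCLM (𝕜 := ℝ) A‖ ^ 2 := by
  have : NeZero d := ⟨by omega⟩
  obtain ⟨x, hx, hx0, hAx⟩ := A.exists_nonneg_norm_toEuclideanCLM_apply_eq hA
  have hsum : ∑ j, max (∑ i, A j i * x i) 0 ^ 2 = ‖Matrix.toEuclideanCLM (𝕜 := ℝ) A‖ ^ 2 := by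
    rw [← hAx, Matrix.norm_toEuclideanCLM_apply_sq]
    refine Finset.sum_congr rfl fun j _ => ?_
    rw [max_eq_left (Finset.sum_nonneg fun i _ => mul_nonneg (hA j i) (hx0 i))]
  refine ⟨⟨⟨x, hx, hsum.symm⟩, ?_⟩, x, hx, hx0, hAx, hsum⟩
  rintro r ⟨y, hy, rfl⟩
  calc ∑ j, max (∑ i, A j i * y i) 0 ^ 2 ≤ ∑ j, (∑ i, A j i * y i) ^ 2 := by
        refine Finset.sum_le_sum fun j _ => sq_le_sq.mpr ?_
        rw [abs_of_nonneg (le_max_right _ _)]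
        exact max_le (le_abs_self _) (abs_nonneg _)
    _ = ‖Matrix.toEuclideanCLM (𝕜 := ℝ) A y‖ ^ 2 := (A.norm_toEuclideanCLM_apply_sq y).symm
    _ ≤ ‖Matrix.toEuclideanCLM (𝕜 := ℝ) A‖ ^ 2 := by
        gcongr
        exact ContinuousLinearMap.unit_le_opNorm _ _ hy.le
end

section
/- Let d ≥ 2, β > 0, let σ(s) = max(s,0) be ReLU, and fix weights ω₁,…,ω_d ∈ ℝ, a₁,…,a_d ∈ ℝ^d satisfying the non-degeneracy condition: for every subset J ⊆ {1,…,d}, the matrix Σ_{j∈J} ω_j a_j a_jᵀ − Σ_{j∉J} ω_j a_j a_jᵀ is not a scalar multiple of the identity. Let μ be a Borel probability measure on S^{d-1} satisfying the normalized-attention stationarity condition: for all x ∈ supp μ, (I − x xᵀ)(∫ exp(β ⟨x,y⟩) y dμ(y)) + ((1/β) ∫ exp(β ⟨x,y⟩) dμ(y)) · (I − x xᵀ)(Σ_{j=1}^{d} ω_j max(⟨a_j, x⟩, 0) a_j) = 0. Then the support of μ has zero measure with respect to the rotation-invariant surface measure σ_d on S^{d-1}; in particular μ is singular with respect to σ_d.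 -/
open MeasureTheory Real
open scoped RealInnerProductSpace

/-- Orthogonal projection `(I - x xᵀ) v` onto the tangent space of the sphere at `x`. -/
noncomputable def tangentProj {d : ℕ} (x v : EuclideanSpace ℝ (Fin d)) :
    EuclideanSpace ℝ (Fin d) :=
  v - ⟪x, v⟫ • x

/-- Topological support of a measure. -/
def measSupport {α : Type*} [TopologicalSpace α] [MeasurableSpace α]
    (μ : Measure α) : Set α :=
  {x | ∀ U : Set α, IsOpen U → x ∈ U → μ U ≠ 0}

section Sphere

variable {E : Type*} [NormedAddCommGroup E] [InnerProductSpace ℝ E] [FiniteDimensional ℝ E]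
  [MeasurableSpace E] [BorelSpace E]

lemma charFun_eq_of_norm_eq {σ : Measure E} (hσ : ∀ R : E ≃ₗᵢ[ℝ] E, σ.map R = σ)
    {v w : E} (h : ‖v‖ = ‖w‖) : charFun σ v = charFun σ w := by
  set R : E ≃ₗᵢ[ℝ] E := (ℝ ∙ (v - w))ᗮ.reflection
  have hR : R v = w := Submodule.reflection_sub h
  rw [charFun_apply, charFun_apply]
  nth_rewrite 2 [← hσ R]
  rw [integral_map (by fun_prop) (by fun_prop)]
  simp_rw [← hR, LinearIsometryEquiv.inner_map_map]

/-- A rotation-invariant probability measure on the unit sphere is unique. -/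
lemma eq_of_forall_map_linearIsometryEquiv_eq {σ τ : Measure E} [IsProbabilityMeasure σ]
    [IsProbabilityMeasure τ] (hσs : ∀ᵐ x ∂σ, ‖x‖ = 1) (hτs : ∀ᵐ x ∂τ, ‖x‖ = 1)
    (hσ : ∀ R : E ≃ₗᵢ[ℝ] E, σ.map R = σ) (hτ : ∀ R : E ≃ₗᵢ[ℝ] E, τ.map R = τ) : σ = τ := by
  refine Measure.ext_of_charFun (funext fun v ↦ ?_)
  have key : ∀ {ρ ρ' : Measure E} [IsProbabilityMeasure ρ'], (∀ᵐ x ∂ρ', ‖x‖ = 1) →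
      (∀ R : E ≃ₗᵢ[ℝ] E, ρ.map R = ρ) → ∫ x, charFun ρ (‖v‖ • x) ∂ρ' = charFun ρ v := by
    intro ρ ρ' _ hs hρ
    have : ∀ᵐ x ∂ρ', charFun ρ (‖v‖ • x) = charFun ρ v := by
      filter_upwards [hs] with x hx
      exact charFun_eq_of_norm_eq hρ (by simp [norm_smul, hx])
    rw [integral_congr_ae this]
    simp
  rw [← key hτs hσ, ← key hσs hτ]
  simp_rw [charFun_apply]
  rw [integral_integral_swap]
  · simp_rw [inner_smul_right, real_inner_comm]
  · refine Integrable.mono' (integrable_const (1 : ℝ)) (by fun_prop) (.of_forall fun p ↦ ?_)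
    simp only [Function.uncurry]
    rw [Complex.norm_exp_ofReal_mul_I]

end Sphere

section SphereAnalytic

variable {E : Type*} [NormedAddCommGroup E] [InnerProductSpace ℝ E]
  {G : Type*} [NormedAddCommGroup G] [NormedSpace ℝ G]

open scoped ContDiff in
lemma analyticAt_inv_norm_smul {x : E} (hx : x ≠ 0) :
    AnalyticAt ℝ (fun x : E ↦ ‖x‖⁻¹ • x) x := by
  have h : AnalyticAt ℝ (fun x : E ↦ ‖x‖) x := by
    have := contDiffAt_norm (n := ω) ℝ hx
    rwa [← contDiffWithinAt_univ, contDiffWithinAt_omega_iff_analyticWithinAt,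
      analyticWithinAt_univ] at this
  exact (h.inv (norm_ne_zero_iff.2 hx)).smul analyticAt_id

variable [FiniteDimensional ℝ E] [MeasurableSpace E] [BorelSpace E]

/-- If every ray from the origin meets `s` in a null set, then `s` is null. -/
lemma measure_eq_zero_of_forall_ray (μ : Measure E) [μ.IsAddHaarMeasure] {s : Set E}
    (hs : MeasurableSet s) (h0 : (0 : E) ∉ s)
    (h : ∀ u : E, ‖u‖ = 1 → volume {r : ℝ | r • u ∈ s} = 0) : μ s = 0 := by
  have hsub : μ s = μ.comap ((↑) : ({0}ᶜ : Set E) → E) ((↑) ⁻¹' s) := by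
    rw [comap_subtype_coe_apply (measurableSet_singleton _).compl, Subtype.image_preimage_coe,
      Set.inter_eq_right.2]
    rintro x hx rfl
    exact h0 hx
  set T := (homeomorphUnitSphereProd E).symm ⁻¹' ((↑) ⁻¹' s)
  have hT : MeasurableSet T :=
    (homeomorphUnitSphereProd E).symm.measurable (measurable_subtype_coe hs)
  have hpre : ((↑) ⁻¹' s : Set ({0}ᶜ : Set E)) = homeomorphUnitSphereProd E ⁻¹' T := by
    ext x; simp [T]
  rw [hsub, hpre,
    μ.measurePreserving_homeomorphUnitSphereProd.measure_preimage hT.nullMeasurableSet,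
    Measure.measure_prod_null hT]
  refine .of_forall fun u ↦ ?_
  refine withDensity_absolutelyContinuous _ _ ?_
  rw [comap_subtype_coe_apply measurableSet_Ioi]
  refine measure_mono_null ?_ (h u (by simp))
  rintro _ ⟨r, hr, rfl⟩
  simpa [T] using hr

/-- The radial extension of an analytic function which does not vanish identically on the sphere
is almost everywhere nonzero. -/
lemma measure_eq_zero_of_analyticOnNhd (μ : Measure E) [μ.IsAddHaarMeasure]
    (hE : 2 ≤ Module.finrank ℝ E) {f : E → G} (hf : AnalyticOnNhd ℝ f Set.univ) {q : E}
    (hq : ‖q‖ = 1) (hfq : f q ≠ 0) : μ {x | f (‖x‖⁻¹ • x) = 0} = 0 := by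
  have hq0 : q ≠ 0 := by rintro rfl; simp at hq
  have hfc : Continuous f := continuousOn_univ.1 hf.continuousOn
  set S := {x : E | f (‖x‖⁻¹ • x) = 0}
  have hS : MeasurableSet S :=
    (show Measurable fun x : E ↦ ‖x‖⁻¹ • x by fun_prop)
      (isClosed_singleton.preimage hfc).measurableSet
  rw [← measure_preimage_add μ q S]
  have hspan : μ (ℝ ∙ q : Submodule ℝ E) = 0 := by
    refine μ.addHaar_submodule _ fun htop ↦ ?_
    have h1 := finrank_span_singleton (K := ℝ) hq0
    rw [htop, finrank_top] at h1
    omega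
  refine measure_mono_null (Set.subset_sdiff_union _ (ℝ ∙ q : Submodule ℝ E))
    (measure_union_null ?_ hspan)
  refine measure_eq_zero_of_forall_ray μ
    ((measurable_const_add q hS).diff (Submodule.closed_of_finiteDimensional _).measurableSet)
    (by simp) fun u hu ↦ ?_
  by_cases hus : u ∈ (ℝ ∙ q : Submodule ℝ E)
  · convert measure_empty (μ := (volume : Measure ℝ))
    ext r
    simpa using fun _ ↦ Submodule.smul_mem _ r hus
  have hne (r : ℝ) : q + r • u ≠ 0 := by
    intro h
    rcases eq_or_ne r 0 with rfl | hr
    · simp [hq0] at h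
    · refine hus (Submodule.mem_span_singleton.2 ⟨-r⁻¹, ?_⟩)
      rw [eq_neg_of_add_eq_zero_left h]
      simp [smul_smul, hr]
  have hg : AnalyticOnNhd ℝ (fun r : ℝ ↦ f (‖q + r • u‖⁻¹ • (q + r • u))) Set.univ := by
    intro r _
    have h1 : AnalyticAt ℝ (fun r : ℝ ↦ q + r • u) r := by fun_prop
    have h2 : AnalyticAt ℝ (fun r : ℝ ↦ ‖q + r • u‖⁻¹ • (q + r • u)) r :=
      (analyticAt_inv_norm_smul (hne r)).comp_of_eq h1 rfl
    exact (hf _ (Set.mem_univ _)).comp_of_eq h2 rfl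
  have hcod := hg.preimage_zero_mem_codiscrete (x := 0) (by simpa [hq] using hfq)
  have hae := ae_restrict_le_codiscreteWithin (μ := (volume : Measure ℝ)) MeasurableSet.univ hcod
  rw [Measure.restrict_univ, mem_ae_iff] at hae
  refine measure_mono_null ?_ hae
  rintro r ⟨hr, -⟩
  simpa [S] using hr

lemma measure_eq_zero_of_invariant {σ : Measure E} [IsProbabilityMeasure σ]
    (hσs : ∀ᵐ x ∂σ, ‖x‖ = 1) (hσ : ∀ R : E ≃ₗᵢ[ℝ] E, σ.map R = σ)
    (hE : 2 ≤ Module.finrank ℝ E) {f : E → G} (hf : AnalyticOnNhd ℝ f Set.univ) {q : E}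
    (hq : ‖q‖ = 1) (hfq : f q ≠ 0) : σ {x | f x = 0} = 0 := by
  set κ : Measure E := ProbabilityTheory.cond volume (Metric.ball 0 1)
  have hball : volume (Metric.ball (0 : E) 1) ≠ 0 :=
    (Metric.isOpen_ball.measure_pos _ ⟨0, by simp⟩).ne'
  have : IsProbabilityMeasure κ :=
    ProbabilityTheory.cond_isProbabilityMeasure_of_finite hball measure_ball_lt_top.ne
  have hn : Measurable fun x : E ↦ ‖x‖⁻¹ • x := by fun_prop
  have hκ : κ ≪ volume := ProbabilityTheory.cond_absolutelyContinuous
  have hκR (R : E ≃ₗᵢ[ℝ] E) : κ.map R = κ := by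
    have h1 := R.measurePreserving.restrict_preimage (s := Metric.ball (0 : E) 1)
      Metric.isOpen_ball.measurableSet
    have h2 : R ⁻¹' Metric.ball (0 : E) 1 = Metric.ball 0 1 := by ext; simp
    rw [h2] at h1
    simp only [κ, ProbabilityTheory.cond, Measure.map_smul, h1.map_eq]
  have : IsProbabilityMeasure (κ.map fun x ↦ ‖x‖⁻¹ • x) :=
    Measure.isProbabilityMeasure_map hn.aemeasurable
  have heq : σ = κ.map fun x ↦ ‖x‖⁻¹ • x := by
    refine eq_of_forall_map_linearIsometryEquiv_eq hσs ?_ hσ fun R ↦ ?_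
    · rw [ae_map_iff hn.aemeasurable (measurableSet_eq_fun (by fun_prop) (by fun_prop))]
      have : Nontrivial E := ⟨q, 0, by rintro rfl; simp at hq⟩
      filter_upwards [hκ.ae_le (compl_mem_ae_iff.2 (measure_singleton (0 : E)))] with x hx
      simp [norm_smul, show x ≠ 0 from hx]
    · nth_rewrite 2 [← hκR R]
      rw [Measure.map_map (by fun_prop) hn, Measure.map_map hn (by fun_prop)]
      congr 1
      ext x
      simp
  have hfc : Continuous f := continuousOn_univ.1 hf.continuousOn
  rw [heq, Measure.map_apply hn (isClosed_eq hfc continuous_const).measurableSet]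
  exact hκ (measure_eq_zero_of_analyticOnNhd volume hE hf hq hfq)

end SphereAnalytic

section ExpIntegral

variable {E : Type*} [NormedAddCommGroup E] [InnerProductSpace ℝ E] [FiniteDimensional ℝ E]
  {G : Type*} [NormedAddCommGroup G] [NormedSpace ℝ G]

/-- The linear map sending `x` to the function `y ↦ β ⟪x, y⟫` on the unit sphere. -/
noncomputable def sphereInner (β : ℝ) : E →L[ℝ] C(Metric.sphere (0 : E) 1, ℝ) :=
  LinearMap.toContinuousLinearMap
    { toFun x := ⟨fun y ↦ β * ⟪x, (y : E)⟫, by fun_prop⟩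
      map_add' x x' := by ext y; simp [inner_add_left, mul_add]
      map_smul' c x := by ext y; simp [inner_smul_left]; ring }

@[simp]
lemma sphereInner_apply (β : ℝ) (x : E) (y : Metric.sphere (0 : E) 1) :
    sphereInner β x y = β * ⟪x, (y : E)⟫ := rfl

lemma exp_sphereInner_apply (β : ℝ) (x : E) (y : Metric.sphere (0 : E) 1) :
    NormedSpace.exp (sphereInner β x) y = Real.exp (β * ⟪x, (y : E)⟫) := by
  rw [NormedSpace.exp_continuousMap_eq, Real.exp_eq_exp_ℝ]
  rfl

variable [MeasurableSpace E] [BorelSpace E]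

omit [NormedSpace ℝ G] in
lemma integrable_comap_of_continuous (μ : Measure E) [IsFiniteMeasure μ]
    {f : Metric.sphere (0 : E) 1 → G} (hf : Continuous f) : Integrable f (μ.comap (↑)) :=
  hf.integrable_of_hasCompactSupport (.of_compactSpace f)

/-- Integration over the unit sphere against a weight `g`, as a functional on continuous
functions. -/
noncomputable def sphereIntegral (μ : Measure E) [IsFiniteMeasure μ] (g : C(E, G)) :
    C(Metric.sphere (0 : E) 1, ℝ) →L[ℝ] G :=
  LinearMap.mkContinuous
    { toFun f := ∫ y : Metric.sphere (0 : E) 1, f y • g y ∂μ.comap (↑)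
      map_add' f f' := by
        simp only [ContinuousMap.add_apply, add_smul]
        exact integral_add (integrable_comap_of_continuous μ (by fun_prop))
          (integrable_comap_of_continuous μ (by fun_prop))
      map_smul' c f := by
        simp [mul_smul, integral_smul] }
    (∫ y : Metric.sphere (0 : E) 1, ‖g y‖ ∂μ.comap (↑)) fun f ↦ by
      rw [mul_comm, ← integral_const_mul]
      refine (norm_integral_le_integral_norm _).trans (integral_mono_of_nonneg
        (.of_forall fun _ ↦ norm_nonneg _)
        (integrable_comap_of_continuous μ (by fun_prop)) (.of_forall fun y ↦ ?_))
      simp only [norm_smul]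
      gcongr
      exact f.norm_coe_le_norm y

omit [NormedSpace ℝ G] in
lemma integrable_of_continuous_of_norm_eq_one {μ : Measure E} [IsFiniteMeasure μ]
    (hμ : ∀ᵐ x ∂μ, ‖x‖ = 1) {f : E → G} (hf : Continuous f) : Integrable f μ := by
  have h := hf.continuousOn.integrableOn_compact (μ := μ) (isCompact_sphere (0 : E) 1)
  rwa [IntegrableOn, Measure.restrict_eq_self_of_ae_mem (by simpa using hμ)] at h

omit [InnerProductSpace ℝ E] [FiniteDimensional ℝ E] in
lemma integral_comap_sphere {μ : Measure E} (hμ : ∀ᵐ x ∂μ, ‖x‖ = 1) (f : E → G) :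
    ∫ y : Metric.sphere (0 : E) 1, f y ∂μ.comap (↑) = ∫ y, f y ∂μ := by
  rw [integral_subtype_comap Metric.isClosed_sphere.measurableSet,
    Measure.restrict_eq_self_of_ae_mem]
  simpa using hμ

lemma sphereIntegral_exp {μ : Measure E} [IsFiniteMeasure μ] (hμ : ∀ᵐ x ∂μ, ‖x‖ = 1)
    (g : C(E, G)) (β : ℝ) (x : E) :
    sphereIntegral μ g (NormedSpace.exp (sphereInner β x)) =
      ∫ y, Real.exp (β * ⟪x, y⟫) • g y ∂μ := by
  rw [← integral_comap_sphere hμ]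
  exact integral_congr_ae (.of_forall fun y ↦ by simp only [exp_sphereInner_apply])

lemma analyticOnNhd_integral_exp_inner {μ : Measure E} [IsFiniteMeasure μ]
    (hμ : ∀ᵐ x ∂μ, ‖x‖ = 1) (g : C(E, G)) (β : ℝ) :
    AnalyticOnNhd ℝ (fun x ↦ ∫ y, Real.exp (β * ⟪x, y⟫) • g y ∂μ) Set.univ := by
  intro x _
  simp_rw [← sphereIntegral_exp hμ]
  exact ((sphereIntegral μ g).analyticAt _).comp
    ((NormedSpace.exp_analytic _).comp ((sphereInner β).analyticAt x))

lemma hasDerivAt_integral_exp_inner {μ : Measure E} [IsFiniteMeasure μ]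
    (hμ : ∀ᵐ x ∂μ, ‖x‖ = 1) (β : ℝ) {γ : ℝ → E} {γ' : E} {t : ℝ} (hγ : HasDerivAt γ γ' t) :
    HasDerivAt (fun t ↦ ∫ y, Real.exp (β * ⟪γ t, y⟫) ∂μ)
      (β * ⟪γ', ∫ y, Real.exp (β * ⟪γ t, y⟫) • y ∂μ⟫) t := by
  have h1 : HasDerivAt (fun t ↦ sphereInner β (γ t)) (sphereInner β γ') t :=
    (sphereInner β).hasFDerivAt.comp_hasDerivAt t hγ
  have h2 := (hasFDerivAt_exp (𝕂 := ℝ) (x := sphereInner β (γ t))).comp_hasDerivAt t h1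
  have h3 := (sphereIntegral μ (.const E (1 : ℝ))).hasFDerivAt.comp_hasDerivAt t h2
  have hfun : (fun t ↦ ∫ y, Real.exp (β * ⟪γ t, y⟫) ∂μ) =
      sphereIntegral μ (.const E (1 : ℝ)) ∘ NormedSpace.exp ∘ fun t ↦ sphereInner β (γ t) := by
    ext s
    simp [sphereIntegral_exp hμ]
  have hval : β * ⟪γ', ∫ y, Real.exp (β * ⟪γ t, y⟫) • y ∂μ⟫ = sphereIntegral μ (.const E (1 : ℝ))
      ((NormedSpace.exp (sphereInner β (γ t)) • 1 : _ →L[ℝ] _) (sphereInner β γ')) := by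
    rw [← integral_inner (integrable_of_continuous_of_norm_eq_one hμ (by fun_prop)),
      ← integral_const_mul, ← integral_comap_sphere hμ]
    refine integral_congr_ae (.of_forall fun y ↦ ?_)
    simp [exp_sphereInner_apply, inner_smul_right]
    ring
  rw [hfun, hval]
  exact h3

end ExpIntegral

section Gaussian

variable {E : Type*} [NormedAddCommGroup E] [InnerProductSpace ℝ E] [FiniteDimensional ℝ E]
  [MeasurableSpace E] [BorelSpace E]

lemma integrable_exp_neg_mul_sq_norm {b : ℝ} (hb : 0 < b) :
    Integrable fun v : E ↦ Real.exp (-b * ‖v‖ ^ 2) := by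
  have := GaussianFourier.integrable_cexp_neg_mul_sq_norm_add (b := (b : ℂ)) (by simpa) 0 (0 : E)
  convert this.re using 2 with v
  simp [← Complex.ofReal_neg, ← Complex.ofReal_pow, ← Complex.ofReal_mul, Complex.exp_ofReal_re]

lemma integral_exp_neg_mul_sq_norm_mul_cos {b : ℝ} (hb : 0 < b) (z : E) :
    ∫ v : E, Real.exp (-b * ‖v‖ ^ 2) * Real.cos ⟪z, v⟫ =
      (π / b) ^ (Module.finrank ℝ E / 2 : ℝ) * Real.exp (-(‖z‖ ^ 2 / (4 * b))) := by
  have h := GaussianFourier.integral_cexp_neg_mul_sq_norm_add (b := (b : ℂ)) (by simpa)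
    Complex.I z
  have hi := GaussianFourier.integrable_cexp_neg_mul_sq_norm_add (b := (b : ℂ)) (by simpa)
    Complex.I z
  have h' := congrArg Complex.re h
  rw [← Complex.reCLM_apply, ← Complex.reCLM.integral_comp_comm hi] at h'
  convert h' using 1
  · congr 1
    ext v
    simp [Complex.exp_re, ← Complex.ofReal_pow]
  · rw [← Complex.ofReal_re (_ * _)]
    congr 1
    push_cast [Complex.ofReal_cpow (show 0 ≤ π / b by positivity)]
    congr 2
    simp
    ring

lemma charFun_im (μ : Measure E) [IsFiniteMeasure μ] (v : E) :
    (charFun μ v).im = ∫ x, Real.sin ⟪x, v⟫ ∂μ := by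
  rw [charFun_apply, ← Complex.imCLM_apply, ← Complex.imCLM.integral_comp_comm]
  · simp [Complex.exp_im]
  · refine Integrable.mono' (integrable_const (1 : ℝ)) (by fun_prop) (.of_forall fun p ↦ ?_)
    rw [Complex.norm_exp_ofReal_mul_I]

lemma integral_exp_neg_mul_sq_norm_mul_sin_mul_sin {β : ℝ} (hβ : 0 < β) {x y : E}
    (hx : ‖x‖ = 1) (hy : ‖y‖ = 1) :
    ∫ v : E, Real.exp (-(2 * β)⁻¹ * ‖v‖ ^ 2) * (Real.sin ⟪x, v⟫ * Real.sin ⟪y, v⟫) =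
      (π / (2 * β)⁻¹) ^ (Module.finrank ℝ E / 2 : ℝ) * Real.exp (-β) / 2 *
        (Real.exp (β * ⟪x, y⟫) - Real.exp (β * ⟪-x, y⟫)) := by
  have hb : 0 < (2 * β)⁻¹ := by positivity
  have hint (z : E) : Integrable fun v : E ↦ Real.exp (-(2 * β)⁻¹ * ‖v‖ ^ 2) * Real.cos ⟪z, v⟫ := by
    refine (integrable_exp_neg_mul_sq_norm hb).mono' (by fun_prop) (.of_forall fun v ↦ ?_)
    rw [norm_mul, Real.norm_of_nonneg (Real.exp_pos _).le]
    exact mul_le_of_le_one_right (Real.exp_pos _).le (Real.abs_cos_le_one _)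
  have hsplit (v : E) : Real.exp (-(2 * β)⁻¹ * ‖v‖ ^ 2) * (Real.sin ⟪x, v⟫ * Real.sin ⟪y, v⟫) =
      2⁻¹ * (Real.exp (-(2 * β)⁻¹ * ‖v‖ ^ 2) * Real.cos ⟪x - y, v⟫ -
        Real.exp (-(2 * β)⁻¹ * ‖v‖ ^ 2) * Real.cos ⟪x + y, v⟫) := by
    rw [inner_sub_left, inner_add_left, Real.cos_sub, Real.cos_add]
    ring
  simp_rw [hsplit]
  rw [integral_const_mul, integral_sub (hint _) (hint _),
    integral_exp_neg_mul_sq_norm_mul_cos hb, integral_exp_neg_mul_sq_norm_mul_cos hb]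
  have h1 : -(‖x - y‖ ^ 2 / (4 * (2 * β)⁻¹)) = -β + β * ⟪x, y⟫ := by
    rw [norm_sub_sq_real, hx, hy]
    field_simp
    ring
  have h2 : -(‖x + y‖ ^ 2 / (4 * (2 * β)⁻¹)) = -β + β * ⟪-x, y⟫ := by
    rw [norm_add_sq_real, hx, hy, inner_neg_left]
    field_simp
    ring
  rw [h1, h2, Real.exp_add, Real.exp_add]
  ring

/-- A probability measure on the unit sphere whose exponential integral is even on the sphere is
invariant under the antipodal map. -/
lemma map_neg_eq_of_integral_exp_inner_eq {μ : Measure E} [IsProbabilityMeasure μ]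
    (hμ : ∀ᵐ x ∂μ, ‖x‖ = 1) {β : ℝ} (hβ : 0 < β)
    (h : ∀ x : E, ‖x‖ = 1 →
      ∫ y, Real.exp (β * ⟪-x, y⟫) ∂μ = ∫ y, Real.exp (β * ⟪x, y⟫) ∂μ) :
    μ.map (fun x ↦ -x) = μ := by
  have hb : 0 < (2 * β)⁻¹ := by positivity
  set w : E → ℝ := fun v ↦ Real.exp (-(2 * β)⁻¹ * ‖v‖ ^ 2)
  have hw : Integrable w := integrable_exp_neg_mul_sq_norm hb
  have hprod : Integrable (fun p : E × (E × E) ↦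
      w p.1 * (Real.sin ⟪p.2.1, p.1⟫ * Real.sin ⟪p.2.2, p.1⟫)) (volume.prod (μ.prod μ)) := by
    refine (hw.comp_fst (μ.prod μ)).mono' (by fun_prop) (.of_forall fun p ↦ ?_)
    rw [norm_mul, norm_mul, Real.norm_of_nonneg (Real.exp_pos _).le]
    exact mul_le_of_le_one_right (Real.exp_pos _).le
      (mul_le_one₀ (Real.abs_sin_le_one _) (norm_nonneg _) (Real.abs_sin_le_one _))
  have hsq (v : E) : ∫ p, w v * (Real.sin ⟪p.1, v⟫ * Real.sin ⟪p.2, v⟫) ∂μ.prod μ =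
      w v * (charFun μ v).im ^ 2 := by
    rw [integral_const_mul, integral_prod_mul (fun x ↦ Real.sin ⟪x, v⟫) fun x ↦ Real.sin ⟪x, v⟫,
      charFun_im, sq]
  have hzero : ∫ v, w v * (charFun μ v).im ^ 2 = 0 := by
    simp_rw [← hsq]
    rw [integral_integral_swap hprod]
    have hae : ∀ᵐ p ∂μ.prod μ, ‖p.1‖ = 1 ∧ ‖p.2‖ = 1 :=
      (Measure.quasiMeasurePreserving_fst.ae hμ).and (Measure.quasiMeasurePreserving_snd.ae hμ)
    rw [integral_congr_ae (hae.mono fun p hp ↦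
      integral_exp_neg_mul_sq_norm_mul_sin_mul_sin hβ hp.1 hp.2), integral_const_mul]
    have hi (s : E → E) (hs : Continuous s) (hs1 : ∀ x, ‖s x‖ = ‖x‖) :
        Integrable (fun p : E × E ↦ Real.exp (β * ⟪s p.1, p.2⟫)) (μ.prod μ) := by
      refine (integrable_const (Real.exp β)).mono' (by fun_prop) (hae.mono fun p hp ↦ ?_)
      rw [Real.norm_of_nonneg (Real.exp_pos _).le, Real.exp_le_exp]
      refine mul_le_of_le_one_right hβ.le ((real_inner_le_norm _ _).trans ?_)
      rw [hs1, hp.1, hp.2, one_mul]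
    have hi1 := hi (fun x ↦ x) continuous_id fun _ ↦ rfl
    have hi2 := hi (fun x ↦ -x) continuous_neg norm_neg
    rw [integral_sub hi1 hi2, integral_prod _ hi1, integral_prod _ hi2,
      integral_congr_ae (hμ.mono h)]
    simp
  have hint : Integrable fun v ↦ w v * (charFun μ v).im ^ 2 := by
    simpa only [hsq] using hprod.integral_prod_left
  have hcont : Continuous fun v ↦ w v * (charFun μ v).im ^ 2 :=
    (show Continuous w by fun_prop).mul ((Complex.continuous_im.comp continuous_charFun).pow 2)
  have hall := (hcont.ae_eq_iff_eq (g := 0) volume continuous_zero).1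
    ((integral_eq_zero_iff_of_nonneg (fun v ↦ by positivity) hint).1 hzero)
  have him (v : E) : (charFun μ v).im = 0 := by
    simpa [w, (Real.exp_pos _).ne'] using congrFun hall v
  have : IsProbabilityMeasure (μ.map fun x ↦ -x) :=
    Measure.isProbabilityMeasure_map (by fun_prop)
  refine Measure.ext_of_charFun (funext fun v ↦ ?_)
  have hneg := charFun_map_smul (μ := μ) (-1) v
  simp only [neg_smul, one_smul] at hneg
  rw [hneg, charFun_neg, Complex.conj_eq_iff_im.2 (him v)]

end Gaussian

section Stationary

variable {E : Type*} [NormedAddCommGroup E] [InnerProductSpace ℝ E]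

lemma exists_norm_eq_one_inner_eq_zero [FiniteDimensional ℝ E] (hE : 2 ≤ Module.finrank ℝ E)
    (x : E) : ∃ u : E, ‖u‖ = 1 ∧ ⟪x, u⟫ = 0 := by
  have hne : (ℝ ∙ x)ᗮ ≠ ⊥ := by
    intro h
    rw [Submodule.orthogonal_eq_bot_iff] at h
    have h1 := finrank_span_le_card (R := ℝ) ({x} : Set E)
    rw [h, finrank_top] at h1
    simp at h1
    omega
  obtain ⟨v, hv, hv0⟩ := Submodule.exists_mem_ne_zero_of_ne_bot hne
  refine ⟨‖v‖⁻¹ • v, by simp [norm_smul, hv0], ?_⟩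
  rw [inner_smul_right, Submodule.mem_orthogonal_singleton_iff_inner_right.1 hv, mul_zero]

/-- If the tangential part of `∇F + F • A x` vanishes on the sphere, where `A` is symmetric and
`F x = ∫ exp (β ⟪x, y⟫) ∂μ`, then `F` is even on the sphere. -/
lemma integral_exp_inner_neg_eq [FiniteDimensional ℝ E] [MeasurableSpace E] [BorelSpace E]
    (hE : 2 ≤ Module.finrank ℝ E) {μ : Measure E} [IsFiniteMeasure μ] (hμ : ∀ᵐ x ∂μ, ‖x‖ = 1)
    {β : ℝ} (hβ : β ≠ 0) {A : E →L[ℝ] E} (hA : ∀ x y, ⟪A x, y⟫ = ⟪x, A y⟫)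
    (h : ∀ x : E, ‖x‖ = 1 → ∃ c : ℝ, ∫ y, Real.exp (β * ⟪x, y⟫) • y ∂μ +
      ((1 / β) * ∫ y, Real.exp (β * ⟪x, y⟫) ∂μ) • A x = c • x) {x : E} (hx : ‖x‖ = 1) :
    ∫ y, Real.exp (β * ⟪-x, y⟫) ∂μ = ∫ y, Real.exp (β * ⟪x, y⟫) ∂μ := by
  obtain ⟨u, hu, hxu⟩ := exists_norm_eq_one_inner_eq_zero hE x
  set γ : ℝ → E := fun t ↦ Real.cos t • x + Real.sin t • u
  set γ' : ℝ → E := fun t ↦ -Real.sin t • x + Real.cos t • u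
  have hγ (t : ℝ) : HasDerivAt γ (γ' t) t :=
    ((Real.hasDerivAt_cos t).smul_const x).add ((Real.hasDerivAt_sin t).smul_const u)
  have hux : ⟪u, x⟫ = 0 := by rw [real_inner_comm, hxu]
  have hxx : ⟪x, x⟫ = 1 := by rw [real_inner_self_eq_norm_sq, hx, one_pow]
  have huu : ⟪u, u⟫ = 1 := by rw [real_inner_self_eq_norm_sq, hu, one_pow]
  have horth (t : ℝ) : ⟪γ' t, γ t⟫ = 0 := by
    simp only [γ, γ', inner_add_left, inner_add_right, inner_smul_left, inner_smul_right, hxu, hux,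
      hxx, huu, conj_trivial]
    ring
  have hnorm (t : ℝ) : ‖γ t‖ = 1 := by
    rw [← sq_eq_sq₀ (norm_nonneg _) zero_le_one, ← real_inner_self_eq_norm_sq]
    simp only [γ, inner_add_left, inner_add_right, inner_smul_left, inner_smul_right, hxu, hux,
      hxx, huu, conj_trivial]
    nlinarith [Real.sin_sq_add_cos_sq t]
  have hquad (t : ℝ) : HasDerivAt (fun t ↦ Real.exp (2⁻¹ * ⟪A (γ t), γ t⟫))
      (Real.exp (2⁻¹ * ⟪A (γ t), γ t⟫) * ⟪γ' t, A (γ t)⟫) t := by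
    have h1 := ((A.hasFDerivAt.comp_hasDerivAt t (hγ t)).inner ℝ (hγ t)).const_mul (2⁻¹ : ℝ)
    refine h1.exp.congr_deriv ?_
    have h2 : ⟪A (γ t), γ' t⟫ = ⟪γ' t, A (γ t)⟫ := real_inner_comm _ _
    simp only [Function.comp_apply]
    rw [hA (γ' t), h2]
    ring
  have hder (t : ℝ) : HasDerivAt (fun t ↦
      (∫ y, Real.exp (β * ⟪γ t, y⟫) ∂μ) * Real.exp (2⁻¹ * ⟪A (γ t), γ t⟫)) 0 t := by
    refine ((hasDerivAt_integral_exp_inner hμ β (hγ t)).mul (hquad t)).congr_deriv ?_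
    obtain ⟨c, hc⟩ := h (γ t) (hnorm t)
    have h2 := congrArg (fun v ↦ ⟪γ' t, v⟫) hc
    simp only [inner_add_right, inner_smul_right, horth, mul_zero] at h2
    field_simp at h2
    linear_combination (Real.exp (2⁻¹ * ⟪A (γ t), γ t⟫)) * h2
  have hconst := is_const_of_deriv_eq_zero (fun t ↦ (hder t).differentiableAt)
    (fun t ↦ (hder t).deriv) π 0
  simpa [γ, (Real.exp_pos _).ne'] using hconst

/-- A linear map for which all unit vectors are eigenvectors is a homothety. -/
lemma exists_eq_smul_one_of_forall_eq_inner_smul {B : E →ₗ[ℝ] E}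
    (h : ∀ x : E, ‖x‖ = 1 → B x - ⟪x, B x⟫ • x = 0) : ∃ c : ℝ, B = c • 1 := by
  refine LinearMap.exists_eq_smul_id_of_forall_notLinearIndependent fun v hv ↦ ?_
  have hv0 : v ≠ 0 := hv.ne_zero 0
  have h1 := h (‖v‖⁻¹ • v) (by simp [norm_smul, hv0])
  rw [sub_eq_zero, map_smul, smul_comm] at h1
  obtain ⟨c, hc⟩ : ∃ c : ℝ, B v = c • v :=
    ⟨_, smul_right_injective E (inv_ne_zero (norm_ne_zero_iff.2 hv0)) h1⟩
  have h3 := LinearIndependent.pair_iff.1 hv c (-1) (by rw [hc, neg_one_smul, add_neg_cancel])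
  norm_num at h3

end Stationary

section Support

lemma measure_compl_measSupport {α : Type*} [TopologicalSpace α] [SecondCountableTopology α]
    [MeasurableSpace α] (μ : Measure α) : μ (measSupport μ)ᶜ = 0 := by
  refine measure_null_of_locally_null _ fun x hx ↦ ?_
  simp only [measSupport, Set.mem_compl_iff, Set.mem_ofPred_eq] at hx
  push Not at hx
  obtain ⟨U, hU, hxU, hμ⟩ := hx
  exact ⟨U, mem_nhdsWithin_of_mem_nhds (hU.mem_nhds hxU), hμ⟩

lemma neg_mem_measSupport {E : Type*} [NormedAddCommGroup E] [MeasurableSpace E] [BorelSpace E]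
    {μ : Measure E} (h : μ.map (fun x ↦ -x) = μ) {x : E} (hx : x ∈ measSupport μ) :
    -x ∈ measSupport μ := by
  intro U hU hxU
  rw [← h, Measure.map_apply measurable_neg hU.measurableSet]
  exact hx _ (hU.preimage continuous_neg) hxU

end Support

/-- The operator `∑ j ∈ J, ω j • a j (a j)ᵀ`. -/
noncomputable def sumRankOne {ι E : Type*} [NormedAddCommGroup E] [InnerProductSpace ℝ E]
    (ω : ι → ℝ) (a : ι → E) (J : Finset ι) : E →L[ℝ] E :=
  ∑ j ∈ J, ω j • (innerSL ℝ (a j)).smulRight (a j)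

section SumRankOne

variable {ι E : Type*} [NormedAddCommGroup E] [InnerProductSpace ℝ E] (ω : ι → ℝ) (a : ι → E)
  (J : Finset ι)

lemma sumRankOne_apply (x : E) : sumRankOne ω a J x = ∑ j ∈ J, (ω j * ⟪a j, x⟫) • a j := by
  simp [sumRankOne, smul_smul]

lemma inner_sumRankOne_left (x y : E) :
    ⟪sumRankOne ω a J x, y⟫ = ⟪x, sumRankOne ω a J y⟫ := by
  simp only [sumRankOne_apply, sum_inner, inner_sum, inner_smul_left, inner_smul_right,
    conj_trivial]
  refine Finset.sum_congr rfl fun j _ ↦ ?_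
  rw [real_inner_comm x (a j)]
  ring

variable [Fintype ι] [DecidableEq ι] {J} {x : E}

omit [DecidableEq ι] in
lemma sum_relu_eq_sumRankOne (hJ : ∀ j, j ∈ J ↔ 0 < ⟪a j, x⟫) :
    ∑ j, (ω j * max ⟪a j, x⟫ 0) • a j = sumRankOne ω a J x := by
  rw [sumRankOne_apply, ← Finset.sum_subset (Finset.subset_univ J)]
  · refine Finset.sum_congr rfl fun j hj ↦ ?_
    rw [max_eq_left ((hJ j).1 hj).le]
  · intro j _ hj
    rw [max_eq_right (not_lt.1 (mt (hJ j).2 hj)), mul_zero, zero_smul]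

lemma sum_relu_neg_eq_sumRankOne_compl (hJ : ∀ j, j ∈ J ↔ 0 < ⟪a j, x⟫) :
    ∑ j, (ω j * max ⟪a j, -x⟫ 0) • a j = -sumRankOne ω a Jᶜ x := by
  rw [sumRankOne_apply, ← Finset.sum_neg_distrib, ← Finset.sum_subset (Finset.subset_univ Jᶜ)]
  · refine Finset.sum_congr rfl fun j hj ↦ ?_
    have := not_lt.1 (mt (hJ j).2 (Finset.mem_compl.1 hj))
    rw [inner_neg_right, max_eq_left (by linarith), mul_neg, neg_smul]
  · intro j _ hj
    have := (hJ j).1 (by simpa using hj)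
    rw [inner_neg_right, max_eq_right (by linarith), mul_zero, zero_smul]

end SumRankOne

section TangentProj

variable {d : ℕ}

lemma tangentProj_neg_left (x v : EuclideanSpace ℝ (Fin d)) :
    tangentProj (-x) v = tangentProj x v := by
  simp [tangentProj]

lemma tangentProj_neg (x v : EuclideanSpace ℝ (Fin d)) :
    tangentProj x (-v) = -tangentProj x v := by
  simp [tangentProj]
  abel

lemma tangentProj_sub (x v w : EuclideanSpace ℝ (Fin d)) :
    tangentProj x (v - w) = tangentProj x v - tangentProj x w := by
  simp [tangentProj, inner_sub_right, sub_smul]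
  abel

open scoped ContDiff in
lemma AnalyticOnNhd.tangentProj {f : EuclideanSpace ℝ (Fin d) → EuclideanSpace ℝ (Fin d)}
    (hf : AnalyticOnNhd ℝ f Set.univ) :
    AnalyticOnNhd ℝ (fun x ↦ tangentProj x (f x)) Set.univ := by
  have h : ContDiff ℝ ω f := contDiff_omega_iff_analyticOnNhd.2 hf
  exact contDiff_omega_iff_analyticOnNhd.1 (h.sub ((contDiff_id.inner ℝ h).smul contDiff_id))

end TangentProj

/-- **Singularity of stationary measures for normalized self-attention with a ReLU
perceptron** (Proposition `unified.log`, first part). Under the non-degeneracy condition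
that for every subset `J ⊆ {1,…,d}` the matrix
`Σ_{j∈J} ω_j a_j a_jᵀ − Σ_{j∉J} ω_j a_j a_jᵀ` is not a scalar multiple of the identity,
any probability measure on `S^{d-1}` satisfying the normalized-attention stationarity
condition has support which is null for the uniform (rotation-invariant) probability
measure on the sphere; in particular it is singular with respect to it. -/
theorem normalized_attention_stationary_support_null
    (d : ℕ) (hd : 2 ≤ d) (β : ℝ) (hβ : 0 < β)
    (ω : Fin d → ℝ) (a : Fin d → EuclideanSpace ℝ (Fin d))
    (hnd : ∀ J : Finset (Fin d), ¬ ∃ c : ℝ,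
      ((∑ j ∈ J, ω j • Matrix.of fun i k : Fin d => a j i * a j k)
        - ∑ j ∈ Jᶜ, ω j • Matrix.of fun i k : Fin d => a j i * a j k)
        = c • (1 : Matrix (Fin d) (Fin d) ℝ))
    (μ : Measure (EuclideanSpace ℝ (Fin d))) [IsProbabilityMeasure μ]
    (hs : μ (Metric.sphere (0 : EuclideanSpace ℝ (Fin d)) 1)ᶜ = 0)
    (hstat : ∀ x ∈ measSupport μ,
      tangentProj x (∫ y, Real.exp (β * ⟪x, y⟫) • y ∂μ)
        + ((1 / β) * ∫ y, Real.exp (β * ⟪x, y⟫) ∂μ) •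
            tangentProj x (∑ j, (ω j * max ⟪a j, x⟫ 0) • a j) = 0)
    -- `σunif` is the uniform probability measure on the sphere: rotation invariant and
    -- concentrated on `S^{d-1}`.
    (σunif : Measure (EuclideanSpace ℝ (Fin d))) [IsProbabilityMeasure σunif]
    (hσs : σunif (Metric.sphere (0 : EuclideanSpace ℝ (Fin d)) 1)ᶜ = 0)
    (hσinv : ∀ R : EuclideanSpace ℝ (Fin d) ≃ₗᵢ[ℝ] EuclideanSpace ℝ (Fin d),
      Measure.map R σunif = σunif) :
    σunif (measSupport μ) = 0 ∧ μ.MutuallySingular σunif := by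
  have hE : 2 ≤ Module.finrank ℝ (EuclideanSpace ℝ (Fin d)) := by simpa using hd
  have hμ : ∀ᵐ x ∂μ, ‖x‖ = 1 := by
    rw [ae_iff]; simpa [Set.compl_def] using hs
  have hσ : ∀ᵐ x ∂σunif, ‖x‖ = 1 := by
    rw [ae_iff]; simpa [Set.compl_def] using hσs
  have key (J : Finset (Fin d)) :
      σunif {x | x ∈ measSupport μ ∧ ∀ j, j ∈ J ↔ 0 < ⟪a j, x⟫} = 0 := by
    by_contra hpos
    set V : EuclideanSpace ℝ (Fin d) → EuclideanSpace ℝ (Fin d) := fun x ↦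
      ∫ y, Real.exp (β * ⟪x, y⟫) • y ∂μ
    set F : EuclideanSpace ℝ (Fin d) → ℝ := fun x ↦ ∫ y, Real.exp (β * ⟪x, y⟫) ∂μ
    have hVan : AnalyticOnNhd ℝ V Set.univ :=
      analyticOnNhd_integral_exp_inner hμ (.id _) β
    have hFan : AnalyticOnNhd ℝ F Set.univ := by
      simpa using analyticOnNhd_integral_exp_inner hμ (.const _ (1 : ℝ)) β
    have hforall {f : EuclideanSpace ℝ (Fin d) → EuclideanSpace ℝ (Fin d)}
        (hf : AnalyticOnNhd ℝ f Set.univ)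
        (h : ∀ x ∈ measSupport μ, (∀ j, j ∈ J ↔ 0 < ⟪a j, x⟫) → f x = 0)
        {x : EuclideanSpace ℝ (Fin d)} (hx : ‖x‖ = 1) : f x = 0 := by
      by_contra hfx
      exact hpos (measure_mono_null (fun y hy ↦ h y hy.1 hy.2)
        (measure_eq_zero_of_invariant hσ hσinv hE hf hx hfx))
    have hsphere {x : EuclideanSpace ℝ (Fin d)} (hx : ‖x‖ = 1) :
        tangentProj x (V x) + ((1 / β) * F x) • tangentProj x (sumRankOne ω a J x) = 0 := by
      refine hforall (hVan.tangentProj.add ((analyticOnNhd_const.mul hFan).smul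
        ((sumRankOne ω a J).analyticOnNhd _).tangentProj)) (fun y hy hJ ↦ ?_) hx
      change tangentProj y (V y) + ((1 / β) * F y) • tangentProj y (sumRankOne ω a J y) = 0
      rw [← sum_relu_eq_sumRankOne ω a hJ]
      exact hstat y hy
    have heven {x : EuclideanSpace ℝ (Fin d)} (hx : ‖x‖ = 1) : F (-x) = F x := by
      refine integral_exp_inner_neg_eq hE hμ hβ.ne' (inner_sumRankOne_left ω a J)
        (fun y hy ↦ ⟨⟪y, V y⟫ + (1 / β * F y) * ⟪y, sumRankOne ω a J y⟫, ?_⟩) hx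
      have h := hsphere hy
      simp only [tangentProj] at h
      rw [← sub_eq_zero, ← h]
      module
    have hneg : μ.map (fun x ↦ -x) = μ :=
      map_neg_eq_of_integral_exp_inner_eq hμ hβ fun x hx ↦ heven hx
    have hFneg (x : EuclideanSpace ℝ (Fin d)) : F (-x) = F x := by
      simp only [F]
      nth_rewrite 1 [← hneg]
      rw [integral_map (by fun_prop) (by fun_prop)]
      simp
    have hVneg (x : EuclideanSpace ℝ (Fin d)) : V (-x) = -V x := by
      simp only [V]
      nth_rewrite 1 [← hneg]
      rw [integral_map (by fun_prop) (by fun_prop)]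
      simp [integral_neg]
    have hFpos (x : EuclideanSpace ℝ (Fin d)) : 0 < F x :=
      integral_exp_pos (integrable_of_continuous_of_norm_eq_one hμ (by fun_prop))
    set B : EuclideanSpace ℝ (Fin d) →L[ℝ] EuclideanSpace ℝ (Fin d) :=
      sumRankOne ω a J - sumRankOne ω a Jᶜ
    have hB {x : EuclideanSpace ℝ (Fin d)} (hx : ‖x‖ = 1) : tangentProj x (B x) = 0 := by
      refine hforall (B.analyticOnNhd _).tangentProj (fun y hy hJ ↦ ?_) hx
      have h1 := hstat y hy
      have h2 := hstat (-y) (neg_mem_measSupport hneg hy)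
      rw [sum_relu_eq_sumRankOne ω a hJ] at h1
      change tangentProj (-y) (V (-y)) + ((1 / β) * F (-y)) • _ = 0 at h2
      change tangentProj y (V y) + ((1 / β) * F y) • _ = 0 at h1
      rw [sum_relu_neg_eq_sumRankOne_compl ω a hJ, hVneg, hFneg, tangentProj_neg_left,
        tangentProj_neg_left, tangentProj_neg, tangentProj_neg] at h2
      have h3 : ((1 / β) * F y) • tangentProj y (B y) = 0 := by
        rw [_root_.sub_apply, tangentProj_sub, smul_sub]
        rw [← add_zero (0 : EuclideanSpace ℝ (Fin d))]
        nth_rewrite 1 [← h1]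
        rw [← h2]
        module
      exact (smul_eq_zero.1 h3).resolve_left (by have := hFpos y; positivity)
    obtain ⟨c, hc⟩ := exists_eq_smul_one_of_forall_eq_inner_smul (B := B.toLinearMap)
      fun x hx ↦ hB hx
    refine hnd J ⟨c, ?_⟩
    ext i k
    have h := congrArg (fun v : EuclideanSpace ℝ (Fin d) ↦ v i)
      (LinearMap.congr_fun hc (EuclideanSpace.single k 1))
    simpa [B, sumRankOne_apply, Matrix.sum_apply, Matrix.one_apply, mul_assoc, mul_comm (a _ i),
      Pi.single_apply, EuclideanSpace.inner_single_right] using h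
  have hnull : σunif (measSupport μ) = 0 := by
    classical
    refine measure_mono_null (fun x hx ↦ ?_) (measure_iUnion_null key)
    exact Set.mem_iUnion.2 ⟨Finset.univ.filter fun j ↦ 0 < ⟪a j, x⟫, hx, by simp⟩
  refine ⟨hnull, .mk (s := (measSupport μ)ᶜ) (t := measSupport μ)
    (measure_compl_measSupport μ) hnull (by simp)⟩
end

section
/- Let d = 2, β > 0, σ(s) = max(s,0), and fix weights ω₁, ω₂ ∈ ℝ, a₁, a₂ ∈ ℝ² satisfying the non-degeneracy condition: for every subset J ⊆ {1,2}, the matrix Σ_{j∈J} ω_j a_j a_jᵀ − Σ_{j∉J} ω_j a_j a_jᵀ is not a scalar multiple of the 2×2 identity. Let μ be a Borel probability measure on the unit circle S¹ ⊂ ℝ² satisfying the normalized-attention stationarity condition: for all x ∈ supp μ, (I − x xᵀ)(∫ exp(β ⟨x,y⟩) y dμ(y)) + ((1/β) ∫ exp(β ⟨x,y⟩) dμ(y)) · (I − x xᵀ)(Σ_{j=1}^{2} ω_j max(⟨a_j, x⟩, 0) a_j) = 0. Then μ is purely atomic with finitely many atoms. -/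
open MeasureTheory Real
open scoped RealInnerProductSpace ENNReal

/-- The entire extension of `t ↦ ∫ exp (β cos (t - s)) dν(s)`. -/
noncomputable def cosExpTransform (β : ℝ) (ν : Measure ℝ) (z : ℂ) : ℂ :=
  ∫ s : ℝ, Complex.exp (β * Complex.cos (z - s)) ∂ν

theorem norm_exp_mul_cos_le {β : ℝ} (hβ : 0 < β) (z : ℂ) (s : ℝ) :
    ‖Complex.exp (β * Complex.cos (z - s))‖ ≤ Real.exp (β * Real.cosh z.im) := by
  rw [Complex.norm_exp, Real.exp_le_exp, Complex.re_ofReal_mul]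
  refine mul_le_mul_of_nonneg_left ?_ hβ.le
  have h : (Complex.cos (z - s)).re = Real.cos (z.re - s) * Real.cosh z.im := by
    have e : z - s = (z.re - s : ℝ) + z.im * Complex.I := by
      apply Complex.ext <;> simp
    rw [e, Complex.cos_add_mul_I]
    simp only [← Complex.ofReal_cos, ← Complex.ofReal_sin, ← Complex.ofReal_cosh,
      ← Complex.ofReal_sinh, ← Complex.ofReal_mul, Complex.sub_re, Complex.re_ofReal_mul,
      Complex.ofReal_re, Complex.I_re, mul_zero, sub_zero]
  rw [h]
  exact mul_le_of_le_one_left (Real.cosh_pos _).le (Real.cos_le_one _)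

theorem norm_complex_sin_le (z : ℂ) : ‖Complex.sin z‖ ≤ Real.cosh z.im := by
  have h : Complex.sin z = (Complex.exp (-z * Complex.I) - Complex.exp (z * Complex.I)) *
    Complex.I / 2 := rfl
  rw [h, Real.cosh_eq, norm_div, norm_mul, Complex.norm_I, mul_one, Complex.norm_two]
  gcongr
  refine (norm_sub_le _ _).trans (le_of_eq ?_)
  simp [Complex.norm_exp]

theorem hasDerivAt_cosExpTransform {β : ℝ} (hβ : 0 < β) (ν : Measure ℝ) [IsProbabilityMeasure ν]
    (z : ℂ) : HasDerivAt (cosExpTransform β ν)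
      (∫ s : ℝ, Complex.exp (β * Complex.cos (z - s)) * (β * -Complex.sin (z - s)) ∂ν) z := by
  obtain ⟨R, hR⟩ : ∃ R, ∀ w ∈ Metric.closedBall z 1, Real.cosh w.im ≤ R := by
    obtain ⟨R, hR⟩ := (isCompact_closedBall z 1).bddAbove_image
      (f := fun w : ℂ => Real.cosh w.im) (by fun_prop)
    exact ⟨R, fun w hw => hR ⟨w, hw, rfl⟩⟩
  refine (hasDerivAt_integral_of_dominated_loc_of_deriv_le (μ := ν)
    (F := fun (z : ℂ) (s : ℝ) => Complex.exp (β * Complex.cos (z - s)))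
    (F' := fun (z : ℂ) (s : ℝ) =>
      Complex.exp (β * Complex.cos (z - s)) * (β * -Complex.sin (z - s)))
    (bound := fun _ => Real.exp (β * R) * (β * R))
    (Metric.closedBall_mem_nhds z one_pos) ?_ ?_ ?_ ?_ (integrable_const _) ?_).2
  · exact .of_forall fun w => (by fun_prop : Continuous _).aestronglyMeasurable
  · exact .of_bound (by fun_prop : Continuous _).aestronglyMeasurable _
      (.of_forall (norm_exp_mul_cos_le hβ z))
  · exact (by fun_prop : Continuous _).aestronglyMeasurable
  · refine .of_forall fun s w hw => ?_
    have h1 := (norm_exp_mul_cos_le hβ w s).trans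
      (Real.exp_le_exp.2 (mul_le_mul_of_nonneg_left (hR w hw) hβ.le))
    have h2 : ‖Complex.sin (w - s)‖ ≤ R :=
      (norm_complex_sin_le (w - s)).trans (by simpa using hR w hw)
    rw [norm_mul, norm_mul, norm_neg, Complex.norm_real, Real.norm_of_nonneg hβ.le]
    gcongr
  · refine .of_forall fun s w _ => ?_
    have h := (((hasDerivAt_id w).sub_const (s : ℂ)).ccos.const_mul (β : ℂ)).cexp
    simpa using h

theorem hasDerivAt_cosExpTransform_ofReal {β : ℝ} (hβ : 0 < β) (ν : Measure ℝ)
    [IsProbabilityMeasure ν] (t : ℝ) : HasDerivAt (cosExpTransform β ν)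
      (∫ s, Real.exp (β * Real.cos (t - s)) * (β * -Real.sin (t - s)) ∂ν : ℝ) t := by
  refine (hasDerivAt_cosExpTransform hβ ν t).congr_deriv ?_
  rw [← integral_complex_ofReal]
  simp

theorem norm_cosExpTransform_le {β : ℝ} (hβ : 0 < β) (ν : Measure ℝ) [IsProbabilityMeasure ν]
    (z : ℂ) : ‖cosExpTransform β ν z‖ ≤ Real.exp (β * Real.cosh z.im) := by
  simpa [cosExpTransform] using norm_integral_le_of_norm_le_const (μ := ν)
    (.of_forall (norm_exp_mul_cos_le hβ z))

theorem cosExpTransform_ofReal (β : ℝ) (ν : Measure ℝ) (t : ℝ) :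
    cosExpTransform β ν t = (∫ s, Real.exp (β * Real.cos (t - s)) ∂ν : ℝ) := by
  rw [cosExpTransform, ← integral_complex_ofReal]
  simp

theorem integral_exp_mul_cos_pos {β : ℝ} (hβ : 0 < β) (ν : Measure ℝ) [IsProbabilityMeasure ν]
    (t : ℝ) : 0 < ∫ s, Real.exp (β * Real.cos (t - s)) ∂ν := by
  refine integral_exp_pos (.of_bound (C := Real.exp β)
    (by fun_prop : Continuous _).aestronglyMeasurable (.of_forall fun s => ?_))
  rw [Real.norm_of_nonneg (Real.exp_pos _).le, Real.exp_le_exp]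
  exact mul_le_of_le_one_right hβ.le (Real.cos_le_one _)

/-- A nonconstant `exp (P cos 2z + Q sin 2z)` outgrows `cosExpTransform` along some vertical
line. -/
theorem trig_coeff_eq_zero_of_mul_exp_eq_const {β : ℝ} (hβ : 0 < β) (ν : Measure ℝ)
    [IsProbabilityMeasure ν] {P Q : ℝ} {K : ℂ} (hK : K ≠ 0)
    (h : ∀ z : ℂ, cosExpTransform β ν z *
      Complex.exp (P * Complex.cos (2 * z) + Q * Complex.sin (2 * z)) = K) :
    P = 0 ∧ Q = 0 := by
  have key : ∀ t : ℝ, 0 ≤ P * Real.cos (2 * t) + Q * Real.sin (2 * t) := by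
    intro t
    by_contra! hneg
    set m := P * Real.cos (2 * t) + Q * Real.sin (2 * t) with hm
    have hbound : ∀ y : ℝ,
        ‖K‖ ≤ Real.exp (β * Real.cosh y + m * (2 * Real.cosh y ^ 2 - 1)) := by
      intro y
      rw [← h (t + y * Complex.I), norm_mul, Real.exp_add]
      refine mul_le_mul ?_ ?_ (norm_nonneg _) (Real.exp_pos _).le
      · simpa using norm_cosExpTransform_le hβ ν (t + y * Complex.I)
      · rw [Complex.norm_exp, Real.exp_le_exp]
        have e : (2 : ℂ) * (t + y * Complex.I) = (2 * t : ℝ) + (2 * y : ℝ) * Complex.I := by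
          push_cast; ring
        have hc : Real.cosh (2 * y) = 2 * Real.cosh y ^ 2 - 1 := by
          rw [Real.cosh_two_mul, Real.sinh_sq]; ring
        rw [e, Complex.cos_add_mul_I, Complex.sin_add_mul_I, ← hc]
        simp only [← Complex.ofReal_cos, ← Complex.ofReal_sin, ← Complex.ofReal_cosh,
          ← Complex.ofReal_sinh, ← Complex.ofReal_mul, Complex.add_re, Complex.re_ofReal_mul,
          Complex.sub_re, Complex.ofReal_re, Complex.I_re]
        rw [hm]
        apply le_of_eq
        ring
    have ht : Filter.Tendsto
        (fun y : ℝ => Real.exp (β * Real.cosh y + m * (2 * Real.cosh y ^ 2 - 1)))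
        Filter.atTop (nhds 0) := by
      refine Real.tendsto_exp_atBot.comp ?_
      have hpoly : Filter.Tendsto (fun c : ℝ => c * (β + 2 * m * c) + -m)
          Filter.atTop Filter.atBot := by
        refine Filter.tendsto_atBot_add_const_right _ _ ?_
        refine Filter.Tendsto.atTop_mul_atBot₀ Filter.tendsto_id ?_
        exact Filter.tendsto_atBot_add_const_left _ _
          (Filter.tendsto_id.const_mul_atTop_of_neg (by linarith))
      have hcosh : Filter.Tendsto Real.cosh Filter.atTop Filter.atTop := by
        refine Filter.tendsto_atTop_mono (fun y => ?_)
          (Real.tendsto_exp_atTop.atTop_div_const two_pos)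
        rw [Real.cosh_eq]
        gcongr
        exact le_add_of_nonneg_right (Real.exp_pos _).le
      exact (hpoly.comp hcosh).congr fun y => by simp only [Function.comp]; ring
    exact hK (norm_le_zero_iff.1 (ge_of_tendsto' ht hbound))
  have h0 := key 0
  have h1 := key (π / 2)
  have h2 := key (π / 4)
  have h3 := key (-(π / 4))
  rw [show 2 * (π / 2) = π by ring] at h1
  rw [show 2 * (π / 4) = π / 2 by ring] at h2
  rw [show 2 * -(π / 4) = -(π / 2) by ring] at h3
  simp at h0 h1 h2 h3
  exact ⟨le_antisymm h1 h0, le_antisymm h3 h2⟩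

/-- If `(log W)'` agrees with the derivative of `-(P cos 2t + Q sin 2t)` on a bounded infinite set
of real points, then `W` is constant. -/
theorem cosExpTransform_const_of_infinite {β : ℝ} (hβ : 0 < β) (ν : Measure ℝ)
    [IsProbabilityMeasure ν] {P Q : ℝ} {S : Set ℝ} (hS : S.Infinite) (hSb : S ⊆ Set.Icc (-π) π)
    (h : ∀ t ∈ S, (∫ s, Real.exp (β * Real.cos (t - s)) * (β * -Real.sin (t - s)) ∂ν) +
      (∫ s, Real.exp (β * Real.cos (t - s)) ∂ν) *
        (-2 * P * Real.sin (2 * t) + 2 * Q * Real.cos (2 * t)) = 0) :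
    ∃ K, ∀ z, cosExpTransform β ν z = K := by
  set E : ℂ → ℂ := fun z => Complex.exp (P * Complex.cos (2 * z) + Q * Complex.sin (2 * z)) with hE
  have hEd : ∀ z, HasDerivAt E
      (E z * (-2 * P * Complex.sin (2 * z) + 2 * Q * Complex.cos (2 * z))) z := by
    intro z
    have h2 : HasDerivAt (fun z : ℂ => 2 * z) 2 z := by
      simpa using (hasDerivAt_id z).const_mul (2 : ℂ)
    have h3 : HasDerivAt E _ z :=
      ((h2.ccos.const_mul (P : ℂ)).add (h2.csin.const_mul (Q : ℂ))).cexp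
    refine h3.congr_deriv ?_
    simp only [hE, Pi.add_apply]
    ring
  set H : ℂ → ℂ := fun z => cosExpTransform β ν z * E z with hH
  have hHdiff : Differentiable ℂ H := fun z =>
    ((hasDerivAt_cosExpTransform hβ ν z).mul (hEd z)).differentiableAt
  have hzero : ∀ t ∈ S, deriv H t = 0 := by
    intro t ht
    have hHd : HasDerivAt H _ t := (hasDerivAt_cosExpTransform_ofReal hβ ν t).mul (hEd t)
    rw [hHd.deriv, cosExpTransform_ofReal]
    have h' := congrArg (fun r : ℝ => (r : ℂ)) (h t ht)
    push_cast at h' ⊢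
    linear_combination E t * h'
  obtain ⟨t₀, -, ht₀⟩ := hS.exists_accPt_of_subset_isCompact isCompact_Icc hSb
  have hderiv : deriv H = 0 := by
    refine AnalyticOnNhd.eq_of_frequently_eq (𝕜 := ℂ) (z₀ := (t₀ : ℂ)) ?_ analyticOnNhd_const ?_
    · exact fun z _ => (hHdiff.analyticAt z).deriv
    · have hc : Filter.Tendsto (fun t : ℝ => (t : ℂ)) (nhdsWithin t₀ {t₀}ᶜ)
          (nhdsWithin (t₀ : ℂ) {(t₀ : ℂ)}ᶜ) := by
        refine tendsto_nhdsWithin_of_tendsto_nhds_of_eventually_within _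
          (Complex.continuous_ofReal.continuousAt.tendsto.mono_left nhdsWithin_le_nhds) ?_
        filter_upwards [self_mem_nhdsWithin] with t ht
        simpa using ht
      exact hc.frequently ((accPt_iff_frequently_nhdsNE.1 ht₀).mono fun t ht => hzero t ht)
  have hconst : ∀ z, H z = H 0 := fun z =>
    is_const_of_deriv_eq_zero hHdiff (fun w => congrFun hderiv w) z 0
  have hH0 : H 0 ≠ 0 := by
    refine mul_ne_zero ?_ (Complex.exp_ne_zero _)
    rw [← Complex.ofReal_zero, cosExpTransform_ofReal]
    exact_mod_cast (integral_exp_mul_cos_pos hβ ν 0).ne'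
  obtain ⟨rfl, rfl⟩ := trig_coeff_eq_zero_of_mul_exp_eq_const hβ ν hH0 hconst
  exact ⟨H 0, fun z => by rw [← hconst z]; simp [hH, hE]⟩

/-- A bounded solution of the recurrence of modified Bessel functions with `c 0 ≠ 0` never
vanishes. -/
theorem ne_zero_of_bessel_recurrence {c : ℕ → ℝ} {b M : ℝ} (hb : 0 < b) (h0 : c 0 ≠ 0)
    (hM : ∀ n, |c n| ≤ M) (hrec : ∀ n : ℕ, c n = c (n + 2) + b * (n + 1) * c (n + 1)) (n : ℕ) :
    c n ≠ 0 := by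
  induction n with
  | zero => exact h0
  | succ n ih =>
    intro hn
    have he : c (n + 2) = c n := by rw [hrec n, hn]; ring
    set d : ℕ → ℝ := fun k => (-1) ^ k * c (n + 2) * c (n + 2 + k) with hd
    have hd2 : ∀ k, d (k + 2) = d k + b * (n + 2 + k + 1) * d (k + 1) := by
      intro k
      have := hrec (n + 2 + k)
      simp only [hd, ← add_assoc] at this ⊢
      rw [this]
      push_cast
      ring
    have hd0 : d 0 = c n ^ 2 := by simp only [hd, add_zero, he]; ring
    have hd1 : d 1 = b * (n + 2) * c n ^ 2 := by
      have := hrec (n + 1)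
      simp only [hd, hn] at this ⊢
      push_cast at this
      linear_combination c (n + 2) * this + b * (n + 2) * (c (n + 2) + c n) * he
    have hpos : 0 < c n ^ 2 := by positivity
    have hnn : ∀ k, 0 ≤ d k ∧ 0 ≤ d (k + 1) := by
      intro k
      induction k with
      | zero => exact ⟨hd0 ▸ hpos.le, by rw [zero_add, hd1]; positivity⟩
      | succ k ihk =>
        refine ⟨ihk.2, ?_⟩
        rw [hd2]
        have := ihk.1
        have := ihk.2
        positivity
    have heven : ∀ k, c n ^ 2 ≤ d (2 * k) := by
      intro k
      induction k with
      | zero => exact hd0.ge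
      | succ k ihk =>
        rw [show 2 * (k + 1) = 2 * k + 2 by ring, hd2]
        have := (hnn (2 * k)).2
        have : 0 ≤ b * (n + 2 + (2 * k : ℕ) + 1) * d (2 * k + 1) := by positivity
        linarith
    have hub : ∀ k, d k ≤ |c n| * M := by
      intro k
      refine (le_abs_self _).trans ?_
      simp only [hd, abs_mul, abs_pow, abs_neg, abs_one, one_pow, one_mul, he]
      exact mul_le_mul_of_nonneg_left (hM _) (abs_nonneg _)
    obtain ⟨k, hk⟩ := exists_nat_gt (|c n| * M / (b * c n ^ 2))
    rw [div_lt_iff₀ (by positivity)] at hk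
    have h3 := hub (2 * k + 1 + 2)
    rw [hd2, show 2 * k + 1 + 1 = 2 * (k + 1) by ring] at h3
    have h4 := (hnn (2 * k)).2
    have h5 : (k : ℝ) * (b * c n ^ 2) ≤ b * (n + 2 + (2 * k + 1 : ℕ) + 1) * d (2 * (k + 1)) := by
      calc (k : ℝ) * (b * c n ^ 2) = b * k * c n ^ 2 := by ring
        _ ≤ _ := by
          refine mul_le_mul ?_ (heven _) hpos.le (by positivity)
          refine mul_le_mul_of_nonneg_left ?_ hb.le
          push_cast
          linarith [(Nat.cast_nonneg k : (0 : ℝ) ≤ k), (Nat.cast_nonneg n : (0 : ℝ) ≤ n)]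
    linarith

theorem integral_exp_mul_cos_mul_cos_ne_zero {β : ℝ} (hβ : 0 < β) (n : ℕ) :
    ∫ u in (-π)..π, Real.exp (β * Real.cos u) * Real.cos (n * u) ≠ 0 := by
  have hint : ∀ f : ℝ → ℝ, Continuous f → IntervalIntegrable f volume (-π) π :=
    fun f hf => hf.intervalIntegrable _ _
  refine ne_zero_of_bessel_recurrence (b := 2 / β)
    (c := fun n : ℕ => ∫ u in (-π)..π, Real.exp (β * Real.cos u) * Real.cos (n * u))
    (M := Real.exp β * |π - -π|) (by positivity) ?_ ?_ ?_ n
  · refine (intervalIntegral.intervalIntegral_pos_of_pos (hint _ (by fun_prop)) (fun u => ?_)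
      (by linarith [Real.pi_pos])).ne'
    simp [Real.exp_pos]
  · intro n
    rw [← Real.norm_eq_abs]
    refine intervalIntegral.norm_integral_le_of_norm_le_const fun u _ => ?_
    rw [norm_mul, Real.norm_of_nonneg (Real.exp_pos _).le]
    refine (mul_le_of_le_one_right (Real.exp_pos _).le (Real.abs_cos_le_one _)).trans ?_
    exact Real.exp_le_exp.2 (mul_le_of_le_one_right hβ.le (Real.cos_le_one _))
  · intro n
    have hderiv : ∀ u : ℝ, HasDerivAt
        (fun u => Real.exp (β * Real.cos u) * Real.sin (((n + 1 : ℕ) : ℝ) * u))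
        (((n + 1 : ℕ) : ℝ) * (Real.exp (β * Real.cos u) * Real.cos (((n + 1 : ℕ) : ℝ) * u)) -
          β / 2 * (Real.exp (β * Real.cos u) * Real.cos (n * u)) +
          β / 2 * (Real.exp (β * Real.cos u) * Real.cos (((n + 2 : ℕ) : ℝ) * u))) u := by
      intro u
      have h1 : HasDerivAt (fun u : ℝ => ((n + 1 : ℕ) : ℝ) * u) ((n + 1 : ℕ) : ℝ) u := by
        simpa using (hasDerivAt_id u).const_mul ((n + 1 : ℕ) : ℝ)
      refine ((((Real.hasDerivAt_cos u).const_mul β).exp).mul h1.sin).congr_deriv ?_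
      have e1 : (n : ℝ) * u = ((n + 1 : ℕ) : ℝ) * u - u := by push_cast; ring
      have e2 : ((n + 2 : ℕ) : ℝ) * u = ((n + 1 : ℕ) : ℝ) * u + u := by push_cast; ring
      rw [e1, e2, Real.cos_sub, Real.cos_add]
      ring
    have h := intervalIntegral.integral_eq_sub_of_hasDerivAt (a := -π) (b := π)
      (fun u _ => hderiv u) (hint _ (by fun_prop))
    rw [intervalIntegral.integral_add (hint _ (by fun_prop)) (hint _ (by fun_prop)),
      intervalIntegral.integral_sub (hint _ (by fun_prop)) (hint _ (by fun_prop)),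
      intervalIntegral.integral_const_mul, intervalIntegral.integral_const_mul,
      intervalIntegral.integral_const_mul, mul_neg, Real.sin_neg, Real.sin_nat_mul_pi] at h
    push_cast at h ⊢
    field_simp
    linarith

theorem integral_cexp_int_mul_I_eq_zero {n : ℤ} (hn : n ≠ 0) :
    ∫ t : ℝ in (-π)..π, Complex.exp (n * Complex.I * t) = 0 := by
  rw [integral_exp_mul_complex (mul_ne_zero (by exact_mod_cast hn) Complex.I_ne_zero),
    div_eq_zero_iff, sub_eq_zero]
  left
  refine Complex.exp_eq_exp_iff_exists_int.2 ⟨n, ?_⟩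
  push_cast
  ring

theorem periodic_exp_mul_cos_mul_cexp (β : ℝ) (n : ℤ) :
    Function.Periodic (fun u : ℝ => Complex.exp (β * Complex.cos u) *
      Complex.exp (n * Complex.I * u)) (2 * π) := by
  intro u
  have h1 : Complex.exp (n * Complex.I * (u + 2 * π)) = Complex.exp (n * Complex.I * u) :=
    Complex.exp_eq_exp_iff_exists_int.2 ⟨n, by ring⟩
  simp only
  push_cast
  rw [Complex.cos_add_two_pi, h1]

theorem integral_exp_mul_cos_mul_cexp_ne_zero {β : ℝ} (hβ : 0 < β) (n : ℤ) :
    ∫ u : ℝ in (-π)..π, Complex.exp (β * Complex.cos u) * Complex.exp (n * Complex.I * u) ≠ 0 := by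
  intro h
  apply integral_exp_mul_cos_mul_cos_ne_zero hβ n.natAbs
  have h2 := congrArg Complex.reCLM h
  rw [← ContinuousLinearMap.intervalIntegral_comp_comm _
    ((by fun_prop : Continuous _).intervalIntegrable _ _), map_zero] at h2
  rw [← h2]
  congr 1 with u
  have e : Complex.exp (β * Complex.cos u) * Complex.exp (n * Complex.I * u) =
      (Real.exp (β * Real.cos u) : ℝ) * Complex.exp ((n * u : ℝ) * Complex.I) := by
    push_cast
    ring_nf
  rw [e, Complex.reCLM_apply, Complex.re_ofReal_mul, Complex.exp_ofReal_mul_I_re]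
  congr 1
  rcases Int.natAbs_eq n with h | h
  · conv_rhs => rw [h]
    simp
  · conv_rhs => rw [h]
    simp

/-- If `cosExpTransform β ν` is constant, all nontrivial Fourier coefficients of `ν` vanish. -/
theorem integral_cexp_eq_zero_of_cosExpTransform_const {β : ℝ} (hβ : 0 < β) (ν : Measure ℝ)
    [IsProbabilityMeasure ν] {K : ℂ} (hK : ∀ t : ℝ, cosExpTransform β ν t = K)
    {n : ℤ} (hn : n ≠ 0) : ∫ s : ℝ, Complex.exp (n * Complex.I * s) ∂ν = 0 := by
  have : IsFiniteMeasure (volume.restrict (Set.uIoc (-π) π)) := by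
    rw [Set.uIoc]
    infer_instance
  have hswap := intervalIntegral_integral_swap (μ := ν) (a := -π) (b := π)
    (f := fun t s => Complex.exp (β * Complex.cos (t - s)) * Complex.exp (n * Complex.I * t)) (by
      refine .of_bound (C := Real.exp β) (by fun_prop : Continuous _).aestronglyMeasurable
        (.of_forall fun p => ?_)
      simp only [Function.uncurry, norm_mul]
      rw [← Complex.ofReal_sub, ← Complex.ofReal_cos, ← Complex.ofReal_mul, Complex.norm_exp,
        Complex.norm_exp, Complex.ofReal_re]
      simpa using mul_le_of_le_one_right hβ.le (Real.cos_le_one (p.1 - p.2)))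
  simp_rw [integral_mul_const] at hswap
  change ∫ t : ℝ in (-π)..π, cosExpTransform β ν t * _ = _ at hswap
  simp_rw [hK, intervalIntegral.integral_const_mul, integral_cexp_int_mul_I_eq_zero hn,
    mul_zero] at hswap
  have hshift : ∀ s : ℝ, ∫ t : ℝ in (-π)..π,
      Complex.exp (β * Complex.cos (t - s)) * Complex.exp (n * Complex.I * t) =
      Complex.exp (n * Complex.I * s) * ∫ u : ℝ in (-π)..π,
        Complex.exp (β * Complex.cos u) * Complex.exp (n * Complex.I * u) := by
    intro s
    have h1 := intervalIntegral.integral_comp_sub_right (a := -π) (b := π)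
      (fun u : ℝ => Complex.exp (β * Complex.cos u) * Complex.exp (n * Complex.I * u)) s
    have h2 := (periodic_exp_mul_cos_mul_cexp β n).intervalIntegral_add_eq (-π - s) (-π)
    rw [show -π - s + 2 * π = π - s by ring, show -π + 2 * π = π by ring] at h2
    rw [← h2, ← h1, ← intervalIntegral.integral_const_mul]
    congr 1 with t
    rw [mul_left_comm, ← Complex.exp_add (n * Complex.I * s)]
    push_cast
    congr 2
    ring
  simp_rw [hshift, integral_mul_const] at hswap
  exact (mul_eq_zero.1 hswap.symm).resolve_right (integral_exp_mul_cos_mul_cexp_ne_zero hβ n)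

theorem integral_cos_pow_of_fourier_eq_zero (ν : Measure ℝ) [IsProbabilityMeasure ν]
    (h : ∀ n : ℤ, n ≠ 0 → ∫ s : ℝ, Complex.exp (n * Complex.I * s) ∂ν = 0) (t : ℝ) (N : ℕ) :
    ∫ s, ((1 + Real.cos (s - t)) / 2) ^ N ∂ν = (N.centralBinom : ℝ) / 4 ^ N := by
  have hexpand : ∀ s : ℝ, ((((1 + Real.cos (s - t)) / 2) ^ N : ℝ) : ℂ) =
      ∑ k ∈ Finset.range (2 * N + 1),
        (((2 * N).choose k : ℂ) / 4 ^ N * Complex.exp (-(((k : ℤ) - N : ℤ) * Complex.I * t))) *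
          Complex.exp (((k : ℤ) - N : ℤ) * Complex.I * s) := by
    intro s
    set ζ := Complex.exp ((s - t) * Complex.I) with hζ
    have hζ0 : ζ ≠ 0 := Complex.exp_ne_zero _
    have h1 : (((1 + Real.cos (s - t)) / 2 : ℝ) : ℂ) = (ζ + 1) ^ 2 * ζ⁻¹ / 4 := by
      push_cast
      rw [Complex.cos, neg_mul, Complex.exp_neg, ← hζ]
      field_simp
      ring
    rw [Complex.ofReal_pow, h1, div_pow, mul_pow, ← pow_mul, add_pow, Finset.sum_mul,
      Finset.sum_div]
    refine Finset.sum_congr rfl fun k _ => ?_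
    have h2 : Complex.exp (-(((k : ℤ) - N : ℤ) * Complex.I * t)) *
        Complex.exp (((k : ℤ) - N : ℤ) * Complex.I * s) = ζ ^ k * ζ⁻¹ ^ N := by
      rw [hζ, ← Complex.exp_neg, ← Complex.exp_nat_mul, ← Complex.exp_nat_mul, ← Complex.exp_add,
        ← Complex.exp_add]
      push_cast
      ring_nf
    rw [mul_assoc _ (Complex.exp _), h2, one_pow]
    ring
  apply Complex.ofReal_injective
  rw [← integral_complex_ofReal]
  simp_rw [hexpand]
  rw [integral_finsetSum _ fun k _ => ?_]
  · simp_rw [integral_const_mul]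
    rw [Finset.sum_eq_single_of_mem N (by simp; omega)]
    · simp [Nat.centralBinom]
    · intro k _ hk
      rw [h _ (by omega), mul_zero]
  · refine Integrable.const_mul ?_ _
    refine .of_bound (C := 1) (by fun_prop : Continuous _).aestronglyMeasurable
      (.of_forall fun s => ?_)
    simp [Complex.norm_exp]

/-- A probability measure whose nontrivial Fourier coefficients vanish charges every arc. -/
theorem not_ae_cos_le_of_fourier_eq_zero (ν : Measure ℝ) [IsProbabilityMeasure ν]
    (h : ∀ n : ℤ, n ≠ 0 → ∫ s : ℝ, Complex.exp (n * Complex.I * s) ∂ν = 0) (t : ℝ)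
    {q : ℝ} (hq : q < 1) : ¬ ∀ᵐ s ∂ν, Real.cos (s - t) ≤ q := by
  intro hae
  have hq1 : -1 ≤ q := by
    obtain ⟨s, hs⟩ := hae.exists
    exact (Real.neg_one_le_cos _).trans hs
  set r := (1 + q) / 2 with hr
  have hr0 : 0 ≤ r := by linarith
  have hr1 : r < 1 := by linarith
  have hbase : ∀ s, 0 ≤ (1 + Real.cos (s - t)) / 2 := fun s => by
    linarith [Real.neg_one_le_cos (s - t)]
  have hle : ∀ N : ℕ, (N.centralBinom : ℝ) / 4 ^ N ≤ r ^ N := by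
    intro N
    rw [← integral_cos_pow_of_fourier_eq_zero ν h t N]
    have h2 : ∫ _, r ^ N ∂ν = r ^ N := by simp
    rw [← h2]
    refine integral_mono_of_nonneg (.of_forall fun s => pow_nonneg (hbase s) N)
      (integrable_const _) ?_
    filter_upwards [hae] with s hs
    exact pow_le_pow_left₀ (hbase s) (by linarith) N
  have hlim := (tendsto_self_mul_const_pow_of_lt_one hr0 hr1).const_mul 2
  rw [mul_zero] at hlim
  obtain ⟨N, hN, hN0⟩ :=
    ((hlim.eventually (gt_mem_nhds one_pos)).and (Filter.eventually_gt_atTop 0)).exists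
  have h1 : (4 : ℝ) ^ N ≤ 2 * N * N.centralBinom := by
    exact_mod_cast Nat.four_pow_le_two_mul_self_mul_centralBinom N hN0
  have h2 := (div_le_iff₀ (by positivity)).1 (hle N)
  have h4 : (0 : ℝ) < 4 ^ N := by positivity
  nlinarith [mul_le_mul_of_nonneg_left h2 (by positivity : (0 : ℝ) ≤ 2 * N)]

local notation "E₂" => EuclideanSpace ℝ (Fin 2)

theorem measSupport_eq_support {α : Type*} [TopologicalSpace α] [MeasurableSpace α]
    (μ : Measure α) : measSupport μ = μ.support := by
  rw [Measure.support_eq_forall_isOpen]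
  ext x
  simp only [measSupport, Set.mem_ofPred_eq, pos_iff_ne_zero]
  exact forall_congr' fun U => forall_comm

theorem exists_eq_sum_dirac_of_finite_support {α : Type*} [TopologicalSpace α]
    [HereditarilyLindelofSpace α] [MeasurableSpace α] [MeasurableSingletonClass α]
    (μ : Measure α) (h : μ.support.Finite) :
    ∃ (s : Finset α) (c : α → ℝ≥0∞), μ = ∑ x ∈ s, c x • Measure.dirac x := by
  classical
  refine ⟨h.toFinset, fun x => μ {x}, Measure.ext fun A hA => ?_⟩
  have h1 : μ A = μ ↑(h.toFinset.filter (· ∈ A)) := by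
    refine measure_congr ?_
    filter_upwards [Measure.support_mem_ae (μ := μ)] with x hx
    have hx' : (x ∈ A) = (x ∈ (↑(h.toFinset.filter (· ∈ A)) : Set α)) := by simp [hx]
    exact hx'
  rw [h1, ← sum_measure_singleton, Finset.sum_filter, Measure.finsetSum_apply]
  refine Finset.sum_congr rfl fun x _ => ?_
  simp [Measure.dirac_apply' _ hA, Set.indicator_apply]

/-- The point of the unit circle at angle `t`. -/
noncomputable def circlePoint (t : ℝ) : E₂ := !₂[Real.cos t, Real.sin t]

/-- The unit tangent vector of the circle at angle `t`. -/
noncomputable def circleTangent (t : ℝ) : E₂ := !₂[-Real.sin t, Real.cos t]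

/-- The polar angle of a point of the plane. -/
noncomputable def polarAngle (y : E₂) : ℝ := Complex.arg (y 0 + y 1 * Complex.I)

theorem measurable_polarAngle : Measurable polarAngle :=
  Complex.measurable_arg.comp (by fun_prop : Continuous _).measurable

theorem polarAngle_mem_Icc (y : E₂) : polarAngle y ∈ Set.Icc (-π) π :=
  ⟨(Complex.neg_pi_lt_arg _).le, Complex.arg_le_pi _⟩

theorem circlePoint_polarAngle {y : E₂} (hy : ‖y‖ = 1) : circlePoint (polarAngle y) = y := by
  have h2 : y 0 ^ 2 + y 1 ^ 2 = 1 := by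
    have := EuclideanSpace.norm_sq_eq y
    simpa [hy, Fin.sum_univ_two] using this.symm
  have hz : ‖(y 0 + y 1 * Complex.I : ℂ)‖ = 1 := by
    rw [Complex.norm_add_mul_I, h2, Real.sqrt_one]
  have hz0 : (y 0 + y 1 * Complex.I : ℂ) ≠ 0 := by
    rw [← norm_ne_zero_iff, hz]
    exact one_ne_zero
  ext i
  fin_cases i
  · simp [circlePoint, polarAngle, Complex.cos_arg hz0, hz]
  · simp [circlePoint, polarAngle, Complex.sin_arg, hz]

theorem inner_circlePoint (t : ℝ) (v : E₂) :
    ⟪circlePoint t, v⟫ = Real.cos t * v 0 + Real.sin t * v 1 := by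
  simp [circlePoint, PiLp.inner_apply, Fin.sum_univ_two, mul_comm]

theorem inner_circleTangent (t : ℝ) (v : E₂) :
    ⟪circleTangent t, v⟫ = -Real.sin t * v 0 + Real.cos t * v 1 := by
  simp [circleTangent, PiLp.inner_apply, Fin.sum_univ_two, mul_comm]

theorem inner_circlePoint_circlePoint (t s : ℝ) :
    ⟪circlePoint t, circlePoint s⟫ = Real.cos (t - s) := by
  rw [inner_circlePoint, Real.cos_sub]
  simp [circlePoint]

theorem inner_circleTangent_circlePoint (t s : ℝ) :
    ⟪circleTangent t, circlePoint s⟫ = -Real.sin (t - s) := by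
  rw [inner_circleTangent, Real.sin_sub]
  simp [circlePoint]
  ring

theorem norm_circlePoint (t : ℝ) : ‖circlePoint t‖ = 1 := by
  have h := real_inner_self_eq_norm_sq (circlePoint t)
  rw [inner_circlePoint_circlePoint, sub_self, Real.cos_zero] at h
  exact (pow_eq_one_iff_of_nonneg (norm_nonneg _) two_ne_zero).1 h.symm

theorem inner_circleTangent_tangentProj (t : ℝ) (v : E₂) :
    ⟪circleTangent t, tangentProj (circlePoint t) v⟫ = ⟪circleTangent t, v⟫ := by
  rw [tangentProj, inner_sub_right, inner_smul_right, inner_circleTangent_circlePoint]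
  simp

/-- The coefficient of `cos 2t` in `½ ∑ ε_j ω_j ⟨a_j, x(t)⟩²`. -/
noncomputable def cosCoeff (ω : Fin 2 → ℝ) (a : Fin 2 → E₂) (ε : Fin 2 → ℝ) : ℝ :=
  ∑ j, ε j * (ω j * (a j 0 ^ 2 - a j 1 ^ 2) / 4)

/-- The coefficient of `sin 2t` in `½ ∑ ε_j ω_j ⟨a_j, x(t)⟩²`. -/
noncomputable def sinCoeff (ω : Fin 2 → ℝ) (a : Fin 2 → E₂) (ε : Fin 2 → ℝ) : ℝ :=
  ∑ j, ε j * (ω j * (a j 0 * a j 1) / 2)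

theorem sum_mul_inner_mul_inner (ω : Fin 2 → ℝ) (a : Fin 2 → E₂) (ε : Fin 2 → ℝ) (t : ℝ) :
    ∑ j, ε j * (ω j * ⟪a j, circlePoint t⟫ * ⟪a j, circleTangent t⟫) =
      -2 * cosCoeff ω a ε * Real.sin (2 * t) + 2 * sinCoeff ω a ε * Real.cos (2 * t) := by
  simp only [cosCoeff, sinCoeff, Finset.mul_sum, Finset.sum_mul, ← Finset.sum_add_distrib]
  refine Finset.sum_congr rfl fun j _ => ?_
  rw [real_inner_comm, inner_circlePoint, real_inner_comm, inner_circleTangent, Real.sin_two_mul,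
    Real.cos_two_mul']
  ring

theorem exists_infinite_inter_fiber {α β : Type*} [Finite β] (f : α → β) {S : Set α}
    (hS : S.Infinite) : ∃ b, (S ∩ f ⁻¹' {b}).Infinite := by
  by_contra! h
  exact hS ((Set.finite_iUnion h).subset fun x hx => Set.mem_iUnion.2 ⟨f x, hx, rfl⟩)

theorem ae_circlePoint_polarAngle {μ : Measure E₂} (hs : μ (Metric.sphere (0 : E₂) 1)ᶜ = 0) :
    ∀ᵐ y ∂μ, circlePoint (polarAngle y) = y := by
  filter_upwards [mem_ae_iff.2 hs] with y hy
  exact circlePoint_polarAngle (mem_sphere_zero_iff_norm.1 hy)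

theorem inner_circleTangent_integral_exp_smul {β : ℝ} (hβ : 0 < β) {μ : Measure E₂}
    [IsProbabilityMeasure μ] (hs : μ (Metric.sphere (0 : E₂) 1)ᶜ = 0) (t : ℝ) :
    ⟪circleTangent t, ∫ y, Real.exp (β * ⟪circlePoint t, y⟫) • y ∂μ⟫ =
      ∫ s, Real.exp (β * Real.cos (t - s)) * -Real.sin (t - s) ∂(μ.map polarAngle) := by
  rw [← integral_inner, integral_map measurable_polarAngle.aemeasurable
    (by fun_prop : Continuous _).aestronglyMeasurable]
  · refine integral_congr_ae ?_
    filter_upwards [ae_circlePoint_polarAngle hs] with y hy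
    rw [inner_smul_right, ← inner_circleTangent_circlePoint, ← inner_circlePoint_circlePoint, hy]
  · refine .of_bound (C := Real.exp β) (by fun_prop : Continuous _).aestronglyMeasurable ?_
    filter_upwards [ae_circlePoint_polarAngle hs] with y hy
    rw [← hy, norm_smul, norm_circlePoint, mul_one, inner_circlePoint_circlePoint,
      Real.norm_of_nonneg (Real.exp_pos _).le, Real.exp_le_exp]
    exact mul_le_of_le_one_right hβ.le (Real.cos_le_one _)

theorem integral_exp_inner_circlePoint (β : ℝ) {μ : Measure E₂}
    (hs : μ (Metric.sphere (0 : E₂) 1)ᶜ = 0) (t : ℝ) :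
    ∫ y, Real.exp (β * ⟪circlePoint t, y⟫) ∂μ =
      ∫ s, Real.exp (β * Real.cos (t - s)) ∂(μ.map polarAngle) := by
  rw [integral_map measurable_polarAngle.aemeasurable
    (by fun_prop : Continuous _).aestronglyMeasurable]
  refine integral_congr_ae ?_
  filter_upwards [ae_circlePoint_polarAngle hs] with y hy
  rw [← inner_circlePoint_circlePoint, hy]

/-- The stationarity condition at the point of angle `t`, tested against the tangent vector. -/
theorem stationary_angular {β : ℝ} (hβ : 0 < β) (ω : Fin 2 → ℝ) (a : Fin 2 → E₂)
    {μ : Measure E₂} [IsProbabilityMeasure μ] (hs : μ (Metric.sphere (0 : E₂) 1)ᶜ = 0) {t : ℝ}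
    (h : tangentProj (circlePoint t) (∫ y, Real.exp (β * ⟪circlePoint t, y⟫) • y ∂μ)
        + ((1 / β) * ∫ y, Real.exp (β * ⟪circlePoint t, y⟫) ∂μ) •
            tangentProj (circlePoint t) (∑ j, (ω j * max ⟪a j, circlePoint t⟫ 0) • a j) = 0) :
    (∫ s, Real.exp (β * Real.cos (t - s)) * (β * -Real.sin (t - s)) ∂(μ.map polarAngle)) +
      (∫ s, Real.exp (β * Real.cos (t - s)) ∂(μ.map polarAngle)) *
        ∑ j, ω j * max ⟪a j, circlePoint t⟫ 0 * ⟪a j, circleTangent t⟫ = 0 := by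
  have h1 := congrArg (fun v => ⟪circleTangent t, v⟫) h
  simp only [inner_add_right, inner_smul_right, inner_zero_right, inner_circleTangent_tangentProj,
    inner_sum, inner_circleTangent_integral_exp_smul hβ hs,
    integral_exp_inner_circlePoint β hs] at h1
  simp_rw [mul_left_comm _ β, integral_const_mul, real_inner_comm (circleTangent t)]
  have h2 := congrArg (β * ·) h1
  simp only [mul_zero] at h2
  rwa [mul_add, ← mul_assoc β (1 / β * _), ← mul_assoc β (1 / β), mul_one_div_cancel hβ.ne',
    one_mul] at h2

/-- A measure on the circle with constant exponential transform charges every arc. -/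
theorem circlePoint_mem_measSupport_of_const {β : ℝ} (hβ : 0 < β) {μ : Measure E₂}
    [IsProbabilityMeasure μ] (hs : μ (Metric.sphere (0 : E₂) 1)ᶜ = 0) {K : ℂ}
    (hK : ∀ z, cosExpTransform β (μ.map polarAngle) z = K) (t : ℝ) :
    circlePoint t ∈ measSupport μ := by
  have := Measure.isProbabilityMeasure_map (μ := μ) measurable_polarAngle.aemeasurable
  intro U hU htU hμU
  obtain ⟨r, hr, hrU⟩ := Metric.isOpen_iff.1 hU _ htU
  refine not_ae_cos_le_of_fourier_eq_zero (μ.map polarAngle)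
    (fun n hn => integral_cexp_eq_zero_of_cosExpTransform_const hβ _ (fun t => hK t) hn) t
    (q := 1 - r ^ 2 / 2) (by linarith [pow_pos hr 2]) ?_
  rw [ae_map_iff measurable_polarAngle.aemeasurable
    (measurableSet_le (by fun_prop) measurable_const)]
  filter_upwards [ae_circlePoint_polarAngle hs, measure_eq_zero_iff_ae_notMem.1 hμU] with y hy hyU
  have h1 : r ≤ ‖circlePoint (polarAngle y) - circlePoint t‖ := by
    rw [hy, ← dist_eq_norm]
    by_contra! hlt
    exact hyU (hrU hlt)
  have h2 := norm_sub_sq_real (circlePoint (polarAngle y)) (circlePoint t)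
  rw [inner_circlePoint_circlePoint, norm_circlePoint, norm_circlePoint] at h2
  have h3 := pow_le_pow_left₀ hr.le h1 2
  linarith

/-- A perceptron drift with vanishing tangential part on the whole circle violates
non-degeneracy for some sign pattern. -/
theorem exists_signed_sum_eq_smul_one (ω : Fin 2 → ℝ) (a : Fin 2 → E₂)
    (h : ∀ t, ∑ j, ω j * max ⟪a j, circlePoint t⟫ 0 * ⟪a j, circleTangent t⟫ = 0) :
    ∃ J : Finset (Fin 2), ∃ c : ℝ,
      ((∑ j ∈ J, ω j • Matrix.of fun i k : Fin 2 => a j i * a j k)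
        - ∑ j ∈ Jᶜ, ω j • Matrix.of fun i k : Fin 2 => a j i * a j k)
        = c • (1 : Matrix (Fin 2) (Fin 2) ℝ) := by
  classical
  obtain ⟨J, hJ⟩ := exists_infinite_inter_fiber
    (fun t : ℝ => Finset.univ.filter fun j => 0 ≤ ⟪a j, circlePoint t⟫)
    (Set.Icc_infinite (zero_lt_one' ℝ))
  set ε : Fin 2 → ℝ := fun j => if j ∈ J then 1 else -1 with hε
  have hfib : ∀ t ∈ Set.Icc (0 : ℝ) 1 ∩
      (fun t : ℝ => Finset.univ.filter fun j => 0 ≤ ⟪a j, circlePoint t⟫) ⁻¹' {J},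
      -2 * cosCoeff ω a ε * Real.sin (2 * t) + 2 * sinCoeff ω a ε * Real.cos (2 * t) = 0 := by
    rintro t ⟨-, ht⟩
    have e1 : circlePoint (t + π) = -circlePoint t := by
      ext i; fin_cases i <;> simp [circlePoint]
    have e2 : circleTangent (t + π) = -circleTangent t := by
      ext i; fin_cases i <;> simp [circleTangent]
    have h1 := h (t + π)
    rw [e1, e2] at h1
    rw [← sum_mul_inner_mul_inner, ← sub_eq_zero_of_eq ((h t).trans h1.symm),
      ← Finset.sum_sub_distrib]
    refine Finset.sum_congr rfl fun j _ => ?_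
    have hmem : j ∈ J ↔ 0 ≤ ⟪a j, circlePoint t⟫ := by
      rw [← Set.mem_singleton_iff.1 ht]
      simp
    by_cases hj : j ∈ J
    · have h0 := hmem.1 hj
      simp [hε, hj, inner_neg_right, h0]
    · have h0 := not_le.1 fun h => hj (hmem.2 h)
      simp [hε, hj, inner_neg_right, h0.le]
  obtain ⟨t₁, ht₁, t₂, ht₂, hne⟩ := hJ.nontrivial
  have h1 := hfib t₁ ht₁
  have h2 := hfib t₂ ht₂
  have hsin : Real.sin (2 * t₁ - 2 * t₂) ≠ 0 := by
    have hb1 := ht₁.1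
    have hb2 := ht₂.1
    simp only [Set.mem_Icc] at hb1 hb2
    rw [Ne, Real.sin_eq_zero_iff_of_lt_of_lt (by linarith [Real.pi_gt_three])
      (by linarith [Real.pi_gt_three])]
    exact fun h => hne (by linarith)
  rw [Real.sin_sub] at hsin
  have hP : cosCoeff ω a ε = 0 := by
    apply (mul_eq_zero.1 _).resolve_right hsin
    linear_combination (-1 / 2) * Real.cos (2 * t₂) * h1 + 1 / 2 * Real.cos (2 * t₁) * h2
  have hQ : sinCoeff ω a ε = 0 := by
    apply (mul_eq_zero.1 _).resolve_right hsin
    linear_combination (-1 / 2) * Real.sin (2 * t₂) * h1 + 1 / 2 * Real.sin (2 * t₁) * h2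
  have hsigned : ∀ f : Fin 2 → ℝ, ∑ j ∈ J, f j - ∑ j ∈ Jᶜ, f j = ∑ j, ε j * f j := by
    intro f
    rw [← Finset.sum_add_sum_compl J, sub_eq_add_neg, ← Finset.sum_neg_distrib]
    congr 1
    · exact Finset.sum_congr rfl fun j hj => by simp [hε, hj]
    · exact Finset.sum_congr rfl fun j hj => by simp [hε, Finset.mem_compl.1 hj]
  refine ⟨J, ∑ j, ε j * (ω j * (a j 0 * a j 0)), ?_⟩
  ext i k
  simp only [Matrix.sub_apply, Matrix.sum_apply, Matrix.smul_apply, Matrix.of_apply, smul_eq_mul]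
  rw [hsigned fun j => ω j * (a j i * a j k)]
  simp only [cosCoeff, sinCoeff, Fin.sum_univ_two] at hP hQ ⊢
  fin_cases i <;> fin_cases k <;> simp <;> linarith

/-- **Atomicity on the circle for normalized self-attention with a ReLU perceptron**
(Proposition `unified.log`, second part, `d = 2`). Under the non-degeneracy condition that
for every subset `J ⊆ {1,2}` the matrix `Σ_{j∈J} ω_j a_j a_jᵀ − Σ_{j∉J} ω_j a_j a_jᵀ` is
not a scalar multiple of the identity, any probability measure on `S¹` satisfying the
normalized-attention stationarity condition is purely atomic with finitely many atoms. -/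
theorem normalized_attention_stationary_on_circle_finite_support
    (β : ℝ) (hβ : 0 < β)
    (ω : Fin 2 → ℝ) (a : Fin 2 → EuclideanSpace ℝ (Fin 2))
    (hnd : ∀ J : Finset (Fin 2), ¬ ∃ c : ℝ,
      ((∑ j ∈ J, ω j • Matrix.of fun i k : Fin 2 => a j i * a j k)
        - ∑ j ∈ Jᶜ, ω j • Matrix.of fun i k : Fin 2 => a j i * a j k)
        = c • (1 : Matrix (Fin 2) (Fin 2) ℝ))
    (μ : Measure (EuclideanSpace ℝ (Fin 2))) [IsProbabilityMeasure μ]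
    (hs : μ (Metric.sphere (0 : EuclideanSpace ℝ (Fin 2)) 1)ᶜ = 0)
    (hstat : ∀ x ∈ measSupport μ,
      tangentProj x (∫ y, Real.exp (β * ⟪x, y⟫) • y ∂μ)
        + ((1 / β) * ∫ y, Real.exp (β * ⟪x, y⟫) ∂μ) •
            tangentProj x (∑ j, (ω j * max ⟪a j, x⟫ 0) • a j) = 0) :
    ∃ (s : Finset (EuclideanSpace ℝ (Fin 2))) (c : EuclideanSpace ℝ (Fin 2) → ℝ≥0∞),
      μ = ∑ x ∈ s, c x • Measure.dirac x := by
  classical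
  have := Measure.isProbabilityMeasure_map (μ := μ) measurable_polarAngle.aemeasurable
  refine exists_eq_sum_dirac_of_finite_support μ ?_
  rw [← measSupport_eq_support]
  by_contra hinf
  set S : Set ℝ := {t | t ∈ Set.Icc (-π) π ∧ circlePoint t ∈ measSupport μ}
  have hSinf : S.Infinite := by
    refine Set.Infinite.of_image circlePoint (Set.Infinite.mono (fun y hy => ?_) hinf)
    have hy1 : ‖y‖ = 1 := by
      by_contra hne
      exact hy _ Metric.isClosed_sphere.isOpen_compl
        (fun h => hne (mem_sphere_zero_iff_norm.1 h)) hs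
    refine ⟨polarAngle y, ⟨polarAngle_mem_Icc y, ?_⟩, circlePoint_polarAngle hy1⟩
    rwa [circlePoint_polarAngle hy1]
  obtain ⟨J, hJ⟩ := exists_infinite_inter_fiber
    (fun t : ℝ => Finset.univ.filter fun j => 0 ≤ ⟪a j, circlePoint t⟫) hSinf
  obtain ⟨K, hK⟩ := cosExpTransform_const_of_infinite hβ (μ.map polarAngle)
    (P := cosCoeff ω a fun j => if j ∈ J then 1 else 0)
    (Q := sinCoeff ω a fun j => if j ∈ J then 1 else 0) hJ (fun t ht => ht.1.1) (by
      rintro t ⟨⟨-, hsupp⟩, ht⟩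
      rw [← sum_mul_inner_mul_inner]
      convert stationary_angular hβ ω a hs (hstat _ hsupp) using 3
      refine Finset.sum_congr rfl fun j _ => ?_
      rw [← Set.mem_singleton_iff.1 ht]
      by_cases h0 : 0 ≤ ⟪a j, circlePoint t⟫
      · simp [h0]
      · simp [h0, max_eq_right (not_le.1 h0).le])
  obtain ⟨J', hJ'⟩ := exists_signed_sum_eq_smul_one ω a fun t => by
    have hT : cosExpTransform β (μ.map polarAngle) = fun _ => K := funext hK
    have hd := hasDerivAt_cosExpTransform_ofReal hβ (μ.map polarAngle) t
    rw [hT] at hd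
    have h0 := Complex.ofReal_eq_zero.1 (hd.unique (hasDerivAt_const _ _))
    have h1 := stationary_angular hβ ω a hs
      (hstat _ (circlePoint_mem_measSupport_of_const hβ hs hK t))
    rw [h0, zero_add] at h1
    exact (mul_eq_zero.1 h1).resolve_left (integral_exp_mul_cos_pos hβ _ t).ne'
  exact hnd J' hJ'
end
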